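/- arXiv:2106.06367 — 2 statements merged into one kernel-verified Lean document; each statement's English description precedes it below -/
import Mathlib

section
/- Let α > 0 and λ = λ₁ + iλ₂ with λ₂ ≥ α|λ₁|/(2√(α+1)), and let u be a Schwartz-class classical solution of equation (1.1) on [0,∞) with initial datum u₀. Then for all t ≥ 0, ‖(𝓛u)(t,·)‖_{L²(ℝ)} ≤ ‖x u₀‖_{L²(ℝ)}, where (𝓛u)(t,x) = (x + c₁ t) u(t,x) − 2 i c₂ t ∂_x u(t,x). -/
open MeasureTheory Real Set

noncomputable section

/-- A Schwartz-class classical solution of equation (1.1),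
`−i ∂_t u + c₂ ∂_x² u + i c₁ ∂_x u − c₀ u = λ |u|^α u`, on `[0,∞) × ℝ`. -/
structure SchwartzSolution (c₂ c₁ c₀ α : ℝ) (lam : ℂ) (u : ℝ → ℝ → ℂ) where
  ut : ℝ → ℝ → ℂ
  ux : ℝ → ℝ → ℂ
  uxx : ℝ → ℝ → ℂ
  hut : ∀ x : ℝ, ∀ t ∈ Ici (0:ℝ), HasDerivWithinAt (fun s => u s x) (ut t x) (Ici 0) t
  hux : ∀ t ∈ Ici (0:ℝ), ∀ x : ℝ, HasDerivAt (fun y => u t y) (ux t x) x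
  huxx : ∀ t ∈ Ici (0:ℝ), ∀ x : ℝ, HasDerivAt (fun y => ux t y) (uxx t x) x
  hu_cont : ContinuousOn (fun p : ℝ × ℝ => u p.1 p.2) (Ici 0 ×ˢ univ)
  hut_cont : ContinuousOn (fun p : ℝ × ℝ => ut p.1 p.2) (Ici 0 ×ˢ univ)
  hux_cont : ContinuousOn (fun p : ℝ × ℝ => ux p.1 p.2) (Ici 0 ×ˢ univ)
  huxx_cont : ContinuousOn (fun p : ℝ × ℝ => uxx p.1 p.2) (Ici 0 ×ˢ univ)
  hdecay : ∀ n : ℕ, ∀ T : ℝ, 0 < T → ∃ C : ℝ, ∀ t ∈ Icc (0:ℝ) T, ∀ x : ℝ,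
    (‖u t x‖ + ‖ut t x‖ + ‖ux t x‖ + ‖uxx t x‖) * (1 + |x|) ^ n ≤ C
  heq : ∀ t : ℝ, 0 < t → ∀ x : ℝ,
    -Complex.I * ut t x + (c₂ : ℂ) * uxx t x + Complex.I * (c₁ : ℂ) * ux t x
      - (c₀ : ℂ) * u t x = lam * Complex.ofReal (‖u t x‖ ^ α) * u t x

/-- A power-type Cauchy–Schwarz inequality for the increments of `x ^ (α + 1)`, `-x⁻¹` and
`x ^ (α / 2)`. -/
lemma rpow_increment_cauchy_schwarz {α R S : ℝ} (hα : 0 < α) (hS : 0 < S) (hSR : S < R) :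
    4 * (α + 1) * (R * S) * (R ^ (α / 2) - S ^ (α / 2)) ^ 2 ≤
      α ^ 2 * ((R ^ (α + 1) - S ^ (α + 1)) * (R - S)) := by
  have hR : 0 < R := hS.trans hSR
  have key : ∀ c : ℝ, 0 ≤ (R ^ (α + 1) - S ^ (α + 1)) / (α + 1)
      - 4 * c / α * (R ^ (α / 2) - S ^ (α / 2)) + c ^ 2 * (S⁻¹ - R⁻¹) := by
    intro c
    have hderiv : ∀ x ∈ Ioi (0 : ℝ), HasDerivAt
        (fun x : ℝ => x ^ (α + 1) / (α + 1) - 4 * c / α * x ^ (α / 2) - c ^ 2 * x⁻¹)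
        ((x ^ (α / 2) - c / x) ^ 2) x := by
      intro x hx
      have hx : 0 < x := hx
      have h1 := (Real.hasDerivAt_rpow_const (p := α + 1) (Or.inl hx.ne')).div_const (α + 1)
      have h2 := (Real.hasDerivAt_rpow_const (p := α / 2) (Or.inl hx.ne')).const_mul (4 * c / α)
      have h3 := (hasDerivAt_inv hx.ne').const_mul (c ^ 2)
      refine ((h1.sub h2).sub h3).congr_deriv ?_
      have e1 : x ^ (α + 1 - 1) = (x ^ (α / 2)) ^ 2 := by
        rw [← Real.rpow_mul_natCast hx.le]; congr 1; push_cast; ring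
      have e2 : x ^ (α / 2 - 1) = x ^ (α / 2) / x := by rw [Real.rpow_sub_one hx.ne']
      rw [e1, e2]
      field_simp
      ring
    have hmono : MonotoneOn
        (fun x : ℝ => x ^ (α + 1) / (α + 1) - 4 * c / α * x ^ (α / 2) - c ^ 2 * x⁻¹)
        (Ioi 0) := by
      refine monotoneOn_of_deriv_nonneg (convex_Ioi 0)
        (fun x hx => (hderiv x hx).continuousAt.continuousWithinAt) ?_ ?_
      · rw [interior_Ioi]
        exact fun x hx => (hderiv x hx).differentiableAt.differentiableWithinAt
      · rw [interior_Ioi]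
        intro x hx
        rw [(hderiv x hx).deriv]
        positivity
    have := hmono (mem_Ioi.2 hS) (mem_Ioi.2 hR) hSR.le
    simp only at this
    rw [sub_div]
    linarith
  set B := R ^ (α / 2) - S ^ (α / 2)
  set A := R ^ (α + 1) - S ^ (α + 1)
  have hc := key (2 * B / (α * (S⁻¹ - R⁻¹)))
  have hDe : S⁻¹ - R⁻¹ = (R - S) / (R * S) := by field_simp
  have hRS : R - S ≠ 0 := (sub_pos.2 hSR).ne'
  have hRS' : 0 < R - S := sub_pos.2 hSR
  rw [hDe] at hc
  have e : A / (α + 1) - 4 * (2 * B / (α * ((R - S) / (R * S)))) / α * B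
      + (2 * B / (α * ((R - S) / (R * S)))) ^ 2 * ((R - S) / (R * S))
      = (α ^ 2 * (A * (R - S)) - 4 * (α + 1) * (R * S) * B ^ 2) / (α ^ 2 * (α + 1) * (R - S)) := by
    field_simp
    ring
  rw [e] at hc
  have := mul_nonneg hc (show 0 ≤ α ^ 2 * (α + 1) * (R - S) by positivity)
  rw [div_mul_cancel₀ _ (by positivity)] at this
  linarith

lemma rpow_norm_sq_gap {α r s : ℝ} (hα : 0 < α) (hr : 0 ≤ r) (hs : 0 ≤ s) :
    4 * (α + 1) * (r * s * (r ^ α - s ^ α)) ^ 2 ≤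
      α ^ 2 * ((r ^ α * r ^ 2 + s ^ α * s ^ 2) ^ 2 - (r * s * (r ^ α + s ^ α)) ^ 2) := by
  have hsq : ∀ {y : ℝ}, 0 < y →
      (y ^ 2) ^ (α / 2) = y ^ α ∧ (y ^ 2) ^ (α + 1) = (y ^ α) ^ 2 * y ^ 2 := by
    intro y hy
    constructor
    · rw [← Real.rpow_natCast_mul hy.le]; congr 1; push_cast; ring
    · rw [Real.rpow_add_one (by positivity), ← Real.rpow_natCast_mul hy.le,
        ← Real.rpow_mul_natCast hy.le]
      congr 2; push_cast; ring
  have main : ∀ {r s : ℝ}, 0 < s → s < r → 4 * (α + 1) * (r * s * (r ^ α - s ^ α)) ^ 2 ≤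
      α ^ 2 * ((r ^ α * r ^ 2 + s ^ α * s ^ 2) ^ 2 - (r * s * (r ^ α + s ^ α)) ^ 2) := by
    intro r s hs hsr
    have h := rpow_increment_cauchy_schwarz hα (pow_pos hs 2)
      (pow_lt_pow_left₀ hsr hs.le two_ne_zero)
    rw [(hsq hs).1, (hsq hs).2, (hsq (hs.trans hsr)).1, (hsq (hs.trans hsr)).2] at h
    calc _ = 4 * (α + 1) * (r ^ 2 * s ^ 2) * (r ^ α - s ^ α) ^ 2 := by ring
      _ ≤ _ := h
      _ = _ := by ring
  rcases hs.eq_or_lt with rfl | hs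
  · have : 0 ≤ α ^ 2 * (r ^ α * r ^ 2) ^ 2 := by positivity
    simpa [Real.zero_rpow hα.ne'] using this
  rcases hr.eq_or_lt with rfl | hr
  · have : 0 ≤ α ^ 2 * (s ^ α * s ^ 2) ^ 2 := by positivity
    simpa [Real.zero_rpow hα.ne'] using this
  rcases lt_trichotomy s r with h | rfl | h
  · exact main hs h
  · refine le_of_eq ?_
    ring
  · have := main hr h
    calc _ = 4 * (α + 1) * (s * r * (s ^ α - r ^ α)) ^ 2 := by ring
      _ ≤ _ := this
      _ = _ := by ring

/-- Monotonicity of `z ↦ -i λ |z|^α z` under the large-dissipation condition. -/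
lemma inner_power_nonlinearity_nonpos {α : ℝ} (hα : 0 < α) {lam : ℂ}
    (hlam : α * |lam.re| / (2 * √(α + 1)) ≤ lam.im) (a b : ℂ) :
    inner ℝ (a - b) (Complex.I * lam * ((‖a‖ ^ α : ℝ) * a - (‖b‖ ^ α : ℝ) * b)) ≤ 0 := by
  have hgap := rpow_norm_sq_gap hα (norm_nonneg a) (norm_nonneg b)
  have ha : a.re ^ 2 + a.im ^ 2 = ‖a‖ ^ 2 := by
    rw [← Complex.normSq_eq_norm_sq, Complex.normSq_apply]; ring
  have hb : b.re ^ 2 + b.im ^ 2 = ‖b‖ ^ 2 := by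
    rw [← Complex.normSq_eq_norm_sq, Complex.normSq_apply]; ring
  set p := ‖a‖ ^ α
  set q := ‖b‖ ^ α
  have hp : 0 ≤ p := by positivity
  have hq : 0 ≤ q := by positivity
  set X := a.re * b.re + a.im * b.im with hX
  set Y := a.im * b.re - a.re * b.im with hY
  have hXY : X ^ 2 + Y ^ 2 = ‖a‖ ^ 2 * ‖b‖ ^ 2 := by rw [← ha, ← hb]; ring
  have hk : 0 < √(α + 1) := Real.sqrt_pos.2 (by linarith)
  have hk2 : √(α + 1) ^ 2 = α + 1 := Real.sq_sqrt (by linarith)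
  set M := p * ‖a‖ ^ 2 + q * ‖b‖ ^ 2 with hM
  have hM0 : 0 ≤ M := by positivity
  have hcs : ∀ σ : ℝ, σ ^ 2 = 1 →
      α * (p + q) * X + σ * (2 * √(α + 1)) * (p - q) * Y ≤ α * M := by
    intro σ hσ
    refine le_of_sq_le_sq ?_ (by positivity)
    have h1 : (α * (p + q) * X + σ * (2 * √(α + 1)) * (p - q) * Y) ^ 2 ≤
        ((α * (p + q)) ^ 2 + (σ * (2 * √(α + 1)) * (p - q)) ^ 2) * (X ^ 2 + Y ^ 2) := by
      nlinarith [sq_nonneg (α * (p + q) * Y - σ * (2 * √(α + 1)) * (p - q) * X)]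
    have h2 : (σ * (2 * √(α + 1)) * (p - q)) ^ 2 = 4 * (α + 1) * (p - q) ^ 2 := by
      rw [mul_pow, mul_pow, mul_pow, hσ, hk2]; ring
    rw [h2, hXY] at h1
    linarith
  have h1 := hcs 1 (by norm_num)
  have h2 := hcs (-1) (by norm_num)
  have hlam' : α * |lam.re| ≤ lam.im * (2 * √(α + 1)) := (div_le_iff₀ (by positivity)).1 hlam
  have hexp : inner ℝ (a - b) (Complex.I * lam * ((p : ℝ) * a - (q : ℝ) * b)) =
      -(lam.im * (M - (p + q) * X)) + lam.re * ((p - q) * Y) := by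
    rw [Complex.inner, hM, ← ha, ← hb]
    simp [hX, hY]
    ring
  rw [hexp]
  set Q := M - (p + q) * X with hQ
  have hZ : |2 * √(α + 1) * ((p - q) * Y)| ≤ α * Q := by
    have hαQ : α * Q = α * M - α * (p + q) * X := by rw [hQ]; ring
    rw [abs_le, hαQ]; constructor <;> linarith
  have hQ0 : 0 ≤ Q := by
    have := (abs_nonneg _).trans hZ
    exact nonneg_of_mul_nonneg_right this hα
  have h3 : lam.re * (2 * √(α + 1) * ((p - q) * Y)) ≤ |lam.re| * (α * Q) := by
    refine (le_abs_self _).trans ?_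
    rw [abs_mul]
    gcongr
  have h4 : α * |lam.re| * Q ≤ lam.im * (2 * √(α + 1)) * Q := by gcongr
  have h5 : (2 * √(α + 1)) * (-(lam.im * Q) + lam.re * ((p - q) * Y)) ≤ 0 := by linarith
  by_contra hcon
  push Not at hcon
  have : 0 < (2 * √(α + 1)) * (-(lam.im * Q) + lam.re * ((p - q) * Y)) := by positivity
  linarith

/-- `w` is a classical `C^{1,2}` function on `[0,∞) × ℝ` with partial derivatives `wt`, `wx`, `wxx`,
all of which are `O((1 + x²)⁻¹)`, uniformly on compact time intervals. -/
structure DecayingClassical (w wt wx wxx : ℝ → ℝ → ℂ) : Prop where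
  hasDerivAt_time : ∀ t, 0 < t → ∀ x, HasDerivAt (fun s => w s x) (wt t x) t
  hasDerivAt_space : ∀ t, 0 ≤ t → ∀ x, HasDerivAt (w t) (wx t x) x
  hasDerivAt_space_space : ∀ t, 0 ≤ t → ∀ x, HasDerivAt (wx t) (wxx t x) x
  continuousOn : ContinuousOn (fun p : ℝ × ℝ => w p.1 p.2) (Ici 0 ×ˢ univ)
  continuousOn_time : ContinuousOn (fun p : ℝ × ℝ => wt p.1 p.2) (Ici 0 ×ˢ univ)
  continuousOn_space : ContinuousOn (fun p : ℝ × ℝ => wx p.1 p.2) (Ici 0 ×ˢ univ)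
  continuousOn_space_space : ContinuousOn (fun p : ℝ × ℝ => wxx p.1 p.2) (Ici 0 ×ˢ univ)
  decay : ∀ T, ∃ C, ∀ t ∈ Icc (0 : ℝ) T, ∀ x,
    ‖w t x‖ + ‖wt t x‖ + ‖wx t x‖ + ‖wxx t x‖ ≤ C * (1 + x ^ 2)⁻¹

lemma continuous_slice {f : ℝ → ℝ → ℂ}
    (hf : ContinuousOn (fun p : ℝ × ℝ => f p.1 p.2) (Ici 0 ×ˢ univ)) {t : ℝ} (ht : 0 ≤ t) :
    Continuous (f t) := by
  rw [← continuousOn_univ]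
  exact hf.comp (f := fun x => (t, x)) (by fun_prop) fun x _ => ⟨ht, mem_univ x⟩

lemma abs_inner_le_of_decay {a b : ℂ} {C D x : ℝ} (ha : ‖a‖ ≤ C * (1 + x ^ 2)⁻¹)
    (hb : ‖b‖ ≤ D * (1 + x ^ 2)⁻¹) : |inner ℝ a b| ≤ C * D * (1 + x ^ 2)⁻¹ := by
  have hpos : 0 < (1 + x ^ 2)⁻¹ := by positivity
  have hle : (1 + x ^ 2)⁻¹ ≤ 1 := inv_le_one_of_one_le₀ (by nlinarith [sq_nonneg x])
  have hC : 0 ≤ C := nonneg_of_mul_nonneg_left ((norm_nonneg a).trans ha) hpos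
  have haC : ‖a‖ ≤ C := ha.trans (mul_le_of_le_one_right hC hle)
  calc |inner ℝ a b| ≤ ‖a‖ * ‖b‖ := abs_real_inner_le_norm a b
    _ ≤ C * (D * (1 + x ^ 2)⁻¹) := by gcongr
    _ = _ := by ring

lemma integrable_inner_of_decay {f g : ℝ → ℂ} {C D : ℝ} (hf : Continuous f) (hg : Continuous g)
    (hfC : ∀ x, ‖f x‖ ≤ C * (1 + x ^ 2)⁻¹) (hgD : ∀ x, ‖g x‖ ≤ D * (1 + x ^ 2)⁻¹) :
    Integrable fun x => inner ℝ (f x) (g x) :=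
  (integrable_inv_one_add_sq.const_mul (C * D)).mono' (hf.inner hg).aestronglyMeasurable
    (Filter.Eventually.of_forall fun x => abs_inner_le_of_decay (hfC x) (hgD x))

lemma norm_mul_add_mul_le_of_decay {a b z z' : ℂ} {C x : ℝ} (ha : ‖a‖ ≤ C * (1 + x ^ 2)⁻¹)
    (hb : ‖b‖ ≤ C * (1 + x ^ 2)⁻¹) : ‖z * a + z' * b‖ ≤ (‖z‖ + ‖z'‖) * C * (1 + x ^ 2)⁻¹ := by
  calc ‖z * a + z' * b‖ ≤ ‖z‖ * ‖a‖ + ‖z'‖ * ‖b‖ := by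
        simpa only [norm_mul] using norm_add_le (z * a) (z' * b)
    _ ≤ ‖z‖ * (C * (1 + x ^ 2)⁻¹) + ‖z'‖ * (C * (1 + x ^ 2)⁻¹) := by gcongr
    _ = _ := by ring

namespace DecayingClassical

variable {w wt wx wxx : ℝ → ℝ → ℂ}

lemma sub {v vt vx vxx : ℝ → ℝ → ℂ} (hv : DecayingClassical v vt vx vxx)
    (hw : DecayingClassical w wt wx wxx) :
    DecayingClassical (fun t x => v t x - w t x) (fun t x => vt t x - wt t x)
      (fun t x => vx t x - wx t x) (fun t x => vxx t x - wxx t x) where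
  hasDerivAt_time t ht x := (hv.hasDerivAt_time t ht x).sub (hw.hasDerivAt_time t ht x)
  hasDerivAt_space t ht x := (hv.hasDerivAt_space t ht x).sub (hw.hasDerivAt_space t ht x)
  hasDerivAt_space_space t ht x :=
    (hv.hasDerivAt_space_space t ht x).sub (hw.hasDerivAt_space_space t ht x)
  continuousOn := hv.continuousOn.sub hw.continuousOn
  continuousOn_time := hv.continuousOn_time.sub hw.continuousOn_time
  continuousOn_space := hv.continuousOn_space.sub hw.continuousOn_space
  continuousOn_space_space := hv.continuousOn_space_space.sub hw.continuousOn_space_space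
  decay T := by
    obtain ⟨C, hC⟩ := hv.decay T
    obtain ⟨D, hD⟩ := hw.decay T
    refine ⟨C + D, fun t ht x => ?_⟩
    have h₀ := norm_sub_le (v t x) (w t x)
    have h₁ := norm_sub_le (vt t x) (wt t x)
    have h₂ := norm_sub_le (vx t x) (wx t x)
    have h₃ := norm_sub_le (vxx t x) (wxx t x)
    have h₄ := hC t ht x
    have h₅ := hD t ht x
    rw [add_mul]
    linarith

lemma continuous (h : DecayingClassical w wt wx wxx) {t : ℝ} (ht : 0 ≤ t) : Continuous (w t) :=
  continuous_slice h.continuousOn ht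

lemma decay_each (h : DecayingClassical w wt wx wxx) (T : ℝ) :
    ∃ C, ∀ t ∈ Icc (0 : ℝ) T, ∀ x, ‖w t x‖ ≤ C * (1 + x ^ 2)⁻¹ ∧ ‖wt t x‖ ≤ C * (1 + x ^ 2)⁻¹ ∧
      ‖wx t x‖ ≤ C * (1 + x ^ 2)⁻¹ ∧ ‖wxx t x‖ ≤ C * (1 + x ^ 2)⁻¹ := by
  obtain ⟨C, hC⟩ := h.decay T
  refine ⟨C, fun t ht x => ?_⟩
  have := hC t ht x
  have h₀ := norm_nonneg (w t x)
  have h₁ := norm_nonneg (wt t x)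
  have h₂ := norm_nonneg (wx t x)
  have h₃ := norm_nonneg (wxx t x)
  refine ⟨?_, ?_, ?_, ?_⟩ <;> linarith

lemma integrable_norm_sq (h : DecayingClassical w wt wx wxx) {t : ℝ} (ht : 0 ≤ t) :
    Integrable fun x => ‖w t x‖ ^ 2 := by
  obtain ⟨C, hC⟩ := h.decay_each t
  have hb := fun x => (hC t ⟨ht, le_rfl⟩ x).1
  have hc := h.continuous ht
  simpa only [real_inner_self_eq_norm_sq] using integrable_inner_of_decay hc hc hb hb

lemma hasDerivAt_integral_norm_sq (h : DecayingClassical w wt wx wxx) {t : ℝ} (ht : 0 < t) :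
    Integrable (fun x => 2 * inner ℝ (w t x) (wt t x)) ∧
      HasDerivAt (fun s => ∫ x, ‖w s x‖ ^ 2) (∫ x, 2 * inner ℝ (w t x) (wt t x)) t := by
  obtain ⟨C, hC⟩ := h.decay_each (t + 1)
  refine hasDerivAt_integral_of_dominated_loc_of_deriv_le
    (F := fun s x => ‖w s x‖ ^ 2) (F' := fun s x => 2 * inner ℝ (w s x) (wt s x))
    (bound := fun x => 2 * (C * C * (1 + x ^ 2)⁻¹))
    (Ioo_mem_nhds ht (lt_add_one t)) ?_ (h.integrable_norm_sq ht.le) ?_ ?_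
    ((integrable_inv_one_add_sq.const_mul _).const_mul _) ?_
  · filter_upwards [Ioi_mem_nhds ht] with s hs
    exact (h.integrable_norm_sq (le_of_lt hs)).aestronglyMeasurable
  · exact (continuous_const.mul ((h.continuous ht.le).inner
      (continuous_slice h.continuousOn_time ht.le))).aestronglyMeasurable
  · refine Filter.Eventually.of_forall fun x s hs => ?_
    have hb := hC s (Ioo_subset_Icc_self hs) x
    rw [Real.norm_eq_abs, abs_mul, abs_two]
    exact mul_le_mul_of_nonneg_left (abs_inner_le_of_decay hb.1 hb.2.1) zero_le_two
  · exact Filter.Eventually.of_forall fun x s hs => (h.hasDerivAt_time s hs.1 x).norm_sq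

lemma continuousOn_integral_norm_sq (h : DecayingClassical w wt wx wxx) (T : ℝ) :
    ContinuousOn (fun s => ∫ x, ‖w s x‖ ^ 2) (Icc 0 T) := by
  obtain ⟨C, hC⟩ := h.decay_each T
  refine continuousOn_of_dominated (bound := fun x => C * C * (1 + x ^ 2)⁻¹) (fun s hs =>
    (h.integrable_norm_sq hs.1).aestronglyMeasurable) (fun s hs => Filter.Eventually.of_forall
    fun x => ?_) (integrable_inv_one_add_sq.const_mul _) (Filter.Eventually.of_forall fun x => ?_)
  · have hb := (hC s hs x).1
    simpa only [real_inner_self_eq_norm_sq, Real.norm_eq_abs] using abs_inner_le_of_decay hb hb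
  · exact (h.continuousOn.comp (f := fun s => (s, x)) (by fun_prop)
      fun s hs => ⟨hs.1, mem_univ x⟩).norm.pow 2

/-- The skew-adjoint operator `-i c₂ ∂_x² + c₁ ∂_x + i c₀` does not change the mass. -/
lemma integral_flux_eq_zero (h : DecayingClassical w wt wx wxx) (c₂ c₁ c₀ : ℝ) {t : ℝ}
    (ht : 0 ≤ t) :
    Integrable (fun x => 2 * inner ℝ (w t x)
      (-Complex.I * c₂ * wxx t x + c₁ * wx t x + Complex.I * c₀ * w t x)) ∧
    ∫ x, 2 * inner ℝ (w t x)
      (-Complex.I * c₂ * wxx t x + c₁ * wx t x + Complex.I * c₀ * w t x) = 0 := by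
  obtain ⟨C, hC⟩ := h.decay_each t
  replace hC := hC t ⟨ht, le_rfl⟩
  have hw := h.continuous ht
  have hwx := continuous_slice h.continuousOn_space ht
  have hwxx := continuous_slice h.continuousOn_space_space ht
  have hflux : ∀ x, HasDerivAt
      (fun x => inner ℝ (w t x) ((-2 * Complex.I * c₂) * wx t x + (c₁ : ℂ) * w t x))
      (inner ℝ (w t x) ((-2 * Complex.I * c₂) * wxx t x + (c₁ : ℂ) * wx t x) +
        inner ℝ (wx t x) ((-2 * Complex.I * c₂) * wx t x + (c₁ : ℂ) * w t x)) x := fun x =>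
    (h.hasDerivAt_space t ht x).inner ℝ (((h.hasDerivAt_space_space t ht x).const_mul _).add
      ((h.hasDerivAt_space t ht x).const_mul _))
  have e : ∀ x, inner ℝ (w t x) ((-2 * Complex.I * c₂) * wxx t x + (c₁ : ℂ) * wx t x) +
        inner ℝ (wx t x) ((-2 * Complex.I * c₂) * wx t x + (c₁ : ℂ) * w t x) =
      2 * inner ℝ (w t x)
        (-Complex.I * c₂ * wxx t x + c₁ * wx t x + Complex.I * c₀ * w t x) := by
    intro x
    simp only [Complex.inner]
    simp
    ring
  have hint : Integrable (fun x =>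
      inner ℝ (w t x) ((-2 * Complex.I * c₂) * wxx t x + (c₁ : ℂ) * wx t x) +
        inner ℝ (wx t x) ((-2 * Complex.I * c₂) * wx t x + (c₁ : ℂ) * w t x)) :=
    (integrable_inner_of_decay hw (by fun_prop) (fun x => (hC x).1)
      fun x => norm_mul_add_mul_le_of_decay (hC x).2.2.2 (hC x).2.2.1).add
    (integrable_inner_of_decay hwx (by fun_prop) (fun x => (hC x).2.2.1)
      fun x => norm_mul_add_mul_le_of_decay (hC x).2.2.1 (hC x).1)
  have hzero := integral_eq_zero_of_hasDerivAt_of_integrable hflux hint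
    (integrable_inner_of_decay hw (by fun_prop) (fun x => (hC x).1)
      fun x => norm_mul_add_mul_le_of_decay (hC x).2.2.1 (hC x).1)
  simp only [e] at hint hzero
  exact ⟨hint, hzero⟩

/-- The mass is nonincreasing for a linear Schrödinger flow with a dissipative source. -/
lemma integral_norm_sq_le (h : DecayingClassical w wt wx wxx) (c₂ c₁ c₀ : ℝ)
    (hdiss : ∀ t, 0 < t → ∀ x, inner ℝ (w t x) (wt t x -
      (-Complex.I * c₂ * wxx t x + c₁ * wx t x + Complex.I * c₀ * w t x)) ≤ 0)
    {t : ℝ} (ht : 0 ≤ t) : ∫ x, ‖w t x‖ ^ 2 ≤ ∫ x, ‖w 0 x‖ ^ 2 := by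
  refine antitoneOn_of_deriv_nonpos (convex_Icc 0 t) (h.continuousOn_integral_norm_sq t) ?_ ?_
    (left_mem_Icc.2 ht) (right_mem_Icc.2 ht) ht
  · rw [interior_Icc]
    exact fun s hs =>
      (h.hasDerivAt_integral_norm_sq hs.1).2.differentiableAt.differentiableWithinAt
  · rw [interior_Icc]
    intro s hs
    obtain ⟨hint, hderiv⟩ := h.hasDerivAt_integral_norm_sq hs.1
    obtain ⟨hint', hzero⟩ := h.integral_flux_eq_zero c₂ c₁ c₀ hs.1.le
    rw [hderiv.deriv, ← hzero]
    refine integral_mono hint hint' fun x => ?_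
    have := hdiss s hs.1 x
    rw [inner_sub_right] at this
    simp only
    linarith

end DecayingClassical

lemma SchwartzSolution.decayingClassical {c₂ c₁ c₀ α : ℝ} {lam : ℂ} {u : ℝ → ℝ → ℂ}
    (sol : SchwartzSolution c₂ c₁ c₀ α lam u) :
    DecayingClassical u sol.ut sol.ux sol.uxx where
  hasDerivAt_time t ht x := (sol.hut x t ht.le).hasDerivAt (Ici_mem_nhds ht)
  hasDerivAt_space := sol.hux
  hasDerivAt_space_space := sol.huxx
  continuousOn := sol.hu_cont
  continuousOn_time := sol.hut_cont
  continuousOn_space := sol.hux_cont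
  continuousOn_space_space := sol.huxx_cont
  decay T := by
    obtain ⟨C, hC⟩ := sol.hdecay 2 (max T 1) (by positivity)
    refine ⟨C, fun t ht x => ?_⟩
    rw [← div_eq_mul_inv, le_div_iff₀ (by positivity)]
    refine le_trans ?_ (hC t ⟨ht.1, ht.2.trans (le_max_left _ _)⟩ x)
    gcongr
    nlinarith [sq_abs x, abs_nonneg x]

/-- The phase `exp (i (h (x + c₁ t) + h² c₂ t))` of the Galilean boost with parameter `h`. -/
def galileanPhase (c₂ c₁ h t x : ℝ) : ℂ :=
  Complex.exp (((h * (x + c₁ * t) + h ^ 2 * c₂ * t : ℝ) : ℂ) * Complex.I)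

lemma norm_galileanPhase (c₂ c₁ h t x : ℝ) : ‖galileanPhase c₂ c₁ h t x‖ = 1 :=
  Complex.norm_exp_ofReal_mul_I _

lemma hasDerivAt_galileanPhase_space (c₂ c₁ h t x : ℝ) :
    HasDerivAt (galileanPhase c₂ c₁ h t) (galileanPhase c₂ c₁ h t x * (h * Complex.I)) x := by
  have h₁ : HasDerivAt (fun x : ℝ => h * (x + c₁ * t) + h ^ 2 * c₂ * t) h x := by
    simpa using (((hasDerivAt_id x).add_const (c₁ * t)).const_mul h).add_const (h ^ 2 * c₂ * t)
  exact (h₁.ofReal_comp.mul_const Complex.I).cexp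

lemma hasDerivAt_galileanPhase_time (c₂ c₁ h t x : ℝ) :
    HasDerivAt (fun s => galileanPhase c₂ c₁ h s x)
      (galileanPhase c₂ c₁ h t x * ((h * c₁ + h ^ 2 * c₂ : ℝ) * Complex.I)) t := by
  have h₁ : HasDerivAt (fun s : ℝ => h * (x + c₁ * s) + h ^ 2 * c₂ * s)
      (h * c₁ + h ^ 2 * c₂) t := by
    refine (((((hasDerivAt_id t).const_mul c₁).const_add x).const_mul h).add
      ((hasDerivAt_id t).const_mul (h ^ 2 * c₂))).congr_deriv ?_
    ring
  exact (h₁.ofReal_comp.mul_const Complex.I).cexp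

lemma hasDerivAt_galileanPhase_parameter (c₂ c₁ t x : ℝ) :
    HasDerivAt (fun h => galileanPhase c₂ c₁ h t x) (((x + c₁ * t : ℝ) : ℂ) * Complex.I) 0 := by
  have h₁ : HasDerivAt (fun h : ℝ => h * (x + c₁ * t) + h ^ 2 * c₂ * t) (x + c₁ * t) 0 := by
    refine (((hasDerivAt_id (0 : ℝ)).mul_const (x + c₁ * t)).add
      (((hasDerivAt_pow 2 (0 : ℝ)).mul_const c₂).mul_const t)).congr_deriv ?_
    simp
  exact (h₁.ofReal_comp.mul_const Complex.I).cexp.congr_deriv (by simp)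

namespace DecayingClassical

variable {w wt wx wxx : ℝ → ℝ → ℂ}

lemma hasDerivAt_comp_line (hw : DecayingClassical w wt wx wxx) (d : ℝ) {t : ℝ} (ht : 0 < t)
    (x : ℝ) : HasDerivAt (fun s => w s (x + d * s))
      (wt t (x + d * t) + d * wx t (x + d * t)) t := by
  have hnhds : ∀ y : ℝ, (Ici (0 : ℝ) ×ˢ (univ : Set ℝ)) ∈ nhds (t, y) := fun y =>
    prod_mem_nhds (Ici_mem_nhds ht) Filter.univ_mem
  have hpos : ∀ᶠ v : ℝ × ℝ in nhds (t, x + d * t), 0 < v.1 :=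
    continuousAt_fst.eventually (Ioi_mem_nhds ht)
  have hF := hasStrictFDerivAt_uncurry_coprod (𝕜 := ℝ) (u := (t, x + d * t)) (f := w)
    (f₁ := fun s y => ContinuousLinearMap.toSpanSingleton ℝ (wt s y))
    (f₂ := fun s y => ContinuousLinearMap.toSpanSingleton ℝ (wx s y))
    (hpos.mono fun v hv => (hw.hasDerivAt_time v.1 hv v.2).hasFDerivAt)
    (hpos.mono fun v hv => (hw.hasDerivAt_space v.1 hv.le v.2).hasFDerivAt)
    ((ContinuousLinearMap.toSpanSingletonCLE (𝕜 := ℝ) (E := ℂ)).continuous.continuousAt.comp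
      (hw.continuousOn_time.continuousAt (hnhds _)))
    ((ContinuousLinearMap.toSpanSingletonCLE (𝕜 := ℝ) (E := ℂ)).continuous.continuousAt.comp
      (hw.continuousOn_space.continuousAt (hnhds _)))
  have hline : HasDerivAt (fun s : ℝ => (s, x + d * s)) (1, d) t := by
    refine (hasDerivAt_id t).prodMk ?_
    simpa using ((hasDerivAt_id t).const_mul d).const_add x
  refine (hF.hasFDerivAt.comp_hasDerivAt t hline).congr_deriv ?_
  simp [Function.HasUncurry.uncurry]

/-- Galilean boosts preserve the class of decaying classical functions. -/
lemma galilean (hw : DecayingClassical w wt wx wxx) (c₂ c₁ h : ℝ) :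
    DecayingClassical
      (fun t x => galileanPhase c₂ c₁ h t x * w t (x + 2 * c₂ * h * t))
      (fun t x => galileanPhase c₂ c₁ h t x *
        ((h * c₁ + h ^ 2 * c₂ : ℝ) * Complex.I * w t (x + 2 * c₂ * h * t)
          + wt t (x + 2 * c₂ * h * t) + (2 * c₂ * h : ℝ) * wx t (x + 2 * c₂ * h * t)))
      (fun t x => galileanPhase c₂ c₁ h t x *
        (h * Complex.I * w t (x + 2 * c₂ * h * t) + wx t (x + 2 * c₂ * h * t)))
      (fun t x => galileanPhase c₂ c₁ h t x *
        (-(h ^ 2 : ℝ) * w t (x + 2 * c₂ * h * t)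
          + (2 * h : ℝ) * Complex.I * wx t (x + 2 * c₂ * h * t)
          + wxx t (x + 2 * c₂ * h * t))) := by
  have hphase : Continuous fun p : ℝ × ℝ => galileanPhase c₂ c₁ h p.1 p.2 := by
    unfold galileanPhase
    fun_prop
  have hcomp : ∀ {f : ℝ → ℝ → ℂ}, ContinuousOn (fun p : ℝ × ℝ => f p.1 p.2) (Ici 0 ×ˢ univ) →
      ContinuousOn (fun p : ℝ × ℝ => f p.1 (p.2 + 2 * c₂ * h * p.1)) (Ici 0 ×ˢ univ) :=
    fun hf => hf.comp (f := fun p : ℝ × ℝ => (p.1, p.2 + 2 * c₂ * h * p.1)) (by fun_prop)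
      fun p hp => ⟨hp.1, mem_univ _⟩
  have hcw := hcomp hw.continuousOn
  have hct := hcomp hw.continuousOn_time
  have hcx := hcomp hw.continuousOn_space
  have hcxx := hcomp hw.continuousOn_space_space
  refine ⟨fun t ht x => ?_, fun t ht x => ?_, fun t ht x => ?_, ?_, ?_, ?_, ?_, fun T => ?_⟩
  · refine ((hasDerivAt_galileanPhase_time c₂ c₁ h t x).mul
      (hw.hasDerivAt_comp_line (2 * c₂ * h) ht x)).congr_deriv ?_
    ring
  · refine ((hasDerivAt_galileanPhase_space c₂ c₁ h t x).mul
      ((hw.hasDerivAt_space t ht _).comp_add_const x (2 * c₂ * h * t))).congr_deriv ?_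
    ring
  · refine ((hasDerivAt_galileanPhase_space c₂ c₁ h t x).mul
      ((((hw.hasDerivAt_space t ht _).comp_add_const x (2 * c₂ * h * t)).const_mul
        (h * Complex.I)).add
      ((hw.hasDerivAt_space_space t ht _).comp_add_const x (2 * c₂ * h * t)))).congr_deriv ?_
    simp only [Pi.add_apply]
    push_cast
    linear_combination galileanPhase c₂ c₁ h t x * h ^ 2 * w t (x + 2 * c₂ * h * t) *
      Complex.I_sq
  · exact hphase.continuousOn.mul hcw
  · exact hphase.continuousOn.mul
      (((continuousOn_const.mul hcw).add hct).add (continuousOn_const.mul hcx))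
  · exact hphase.continuousOn.mul ((continuousOn_const.mul hcw).add hcx)
  · exact hphase.continuousOn.mul
      (((continuousOn_const.mul hcw).add (continuousOn_const.mul hcx)).add hcxx)
  · obtain ⟨C, hC⟩ := hw.decay T
    set K := 3 + |h * c₁ + h ^ 2 * c₂| + |2 * c₂ * h| + |h| + h ^ 2 + |2 * h|
    refine ⟨K * (C * (2 * (1 + (2 * c₂ * h * T) ^ 2))), fun t ht x => ?_⟩
    simp only [norm_mul, norm_galileanPhase, one_mul]
    set y := x + 2 * c₂ * h * t with hy
    have hwy := hC t ht y
    have n₀ := norm_nonneg (w t y)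
    have n₁ := norm_nonneg (wt t y)
    have n₂ := norm_nonneg (wx t y)
    have n₃ := norm_nonneg (wxx t y)
    set N := ‖w t y‖ + ‖wt t y‖ + ‖wx t y‖ + ‖wxx t y‖ with hN
    have hC0 : 0 ≤ C := nonneg_of_mul_nonneg_left (le_trans (by positivity) hwy)
      (show 0 < (1 + y ^ 2)⁻¹ by positivity)
    have hshift : (1 + y ^ 2)⁻¹ ≤ 2 * (1 + (2 * c₂ * h * T) ^ 2) * (1 + x ^ 2)⁻¹ := by
      rw [inv_le_iff_one_le_mul₀ (by positivity), mul_right_comm, ← div_eq_mul_inv,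
        one_le_div (by positivity)]
      have hd : (2 * c₂ * h * t) ^ 2 ≤ (2 * c₂ * h * T) ^ 2 := by
        rw [mul_pow, mul_pow _ T]
        have := ht.1
        have := ht.2
        gcongr
      have hx : x = y - 2 * c₂ * h * t := by rw [hy]; ring
      have hx2 : x ^ 2 ≤ 2 * y ^ 2 + 2 * (2 * c₂ * h * t) ^ 2 := by
        rw [hx]
        nlinarith [sq_nonneg (y + 2 * c₂ * h * t)]
      nlinarith [mul_nonneg (sq_nonneg (2 * c₂ * h * T)) (sq_nonneg y)]
    have b₁ : ‖((h * c₁ + h ^ 2 * c₂ : ℝ) : ℂ) * Complex.I * w t y + wt t y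
        + ((2 * c₂ * h : ℝ) : ℂ) * wx t y‖ ≤
        |h * c₁ + h ^ 2 * c₂| * ‖w t y‖ + ‖wt t y‖ + |2 * c₂ * h| * ‖wx t y‖ := by
      refine (norm_add₃_le).trans_eq ?_
      simp only [norm_mul, Complex.norm_I, mul_one, Complex.norm_real, Real.norm_eq_abs,
        abs_mul]
    have b₂ : ‖(h : ℂ) * Complex.I * w t y + wx t y‖ ≤ |h| * ‖w t y‖ + ‖wx t y‖ := by
      refine (norm_add_le _ _).trans_eq ?_
      simp only [norm_mul, Complex.norm_I, mul_one, Complex.norm_real, Real.norm_eq_abs]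
    have b₃ : ‖-((h ^ 2 : ℝ) : ℂ) * w t y + ((2 * h : ℝ) : ℂ) * Complex.I * wx t y + wxx t y‖ ≤
        h ^ 2 * ‖w t y‖ + |2 * h| * ‖wx t y‖ + ‖wxx t y‖ := by
      refine (norm_add₃_le).trans_eq ?_
      simp only [norm_mul, norm_neg, Complex.norm_I, mul_one, Complex.norm_real,
        Real.norm_eq_abs, abs_sq, abs_mul]
    have hsum : ‖w t y‖ + (|h * c₁ + h ^ 2 * c₂| * ‖w t y‖ + ‖wt t y‖ + |2 * c₂ * h| * ‖wx t y‖)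
        + (|h| * ‖w t y‖ + ‖wx t y‖) + (h ^ 2 * ‖w t y‖ + |2 * h| * ‖wx t y‖ + ‖wxx t y‖)
        ≤ K * N := by
      have m₀ : ‖w t y‖ ≤ N := by rw [hN]; linarith
      have m₂ : ‖wx t y‖ ≤ N := by rw [hN]; linarith
      have e₁ := mul_le_mul_of_nonneg_left m₀ (abs_nonneg (h * c₁ + h ^ 2 * c₂))
      have e₂ := mul_le_mul_of_nonneg_left m₂ (abs_nonneg (2 * c₂ * h))
      have e₃ := mul_le_mul_of_nonneg_left m₀ (abs_nonneg h)
      have e₄ := mul_le_mul_of_nonneg_left m₀ (sq_nonneg h)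
      have e₅ := mul_le_mul_of_nonneg_left m₂ (abs_nonneg (2 * h))
      have e₆ : 0 ≤ N := n₀.trans m₀
      have : K * N = 3 * N + |h * c₁ + h ^ 2 * c₂| * N + |2 * c₂ * h| * N + |h| * N + h ^ 2 * N
        + |2 * h| * N := by ring
      linarith
    calc _ ≤ K * N := by linarith
      _ ≤ K * (C * (2 * (1 + (2 * c₂ * h * T) ^ 2) * (1 + x ^ 2)⁻¹)) := by
        have hK : 0 ≤ K := by positivity
        gcongr
        exact hwy.trans (mul_le_mul_of_nonneg_left hshift hC0)
      _ = _ := by ring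

end DecayingClassical

lemma eLpNorm_two_le_of_integral_norm_sq_le {f g : ℝ → ℂ} (hf : Continuous f) (hg : Continuous g)
    (hf2 : Integrable fun x => ‖f x‖ ^ 2) (hg2 : Integrable fun x => ‖g x‖ ^ 2)
    (hle : ∫ x, ‖f x‖ ^ 2 ≤ ∫ x, ‖g x‖ ^ 2) : eLpNorm f 2 volume ≤ eLpNorm g 2 volume := by
  have hfm := (memLp_two_iff_integrable_sq_norm hf.aestronglyMeasurable).2 hf2
  have hgm := (memLp_two_iff_integrable_sq_norm hg.aestronglyMeasurable).2 hg2
  rw [hfm.eLpNorm_eq_integral_rpow_norm two_ne_zero ENNReal.ofNat_ne_top,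
    hgm.eLpNorm_eq_integral_rpow_norm two_ne_zero ENNReal.ofNat_ne_top]
  simp only [ENNReal.toReal_ofNat, Real.rpow_ofNat]
  refine ENNReal.ofReal_le_ofReal (Real.rpow_le_rpow ?_ hle (by norm_num))
  positivity

namespace SchwartzSolution

variable {c₂ c₁ c₀ α : ℝ} {lam : ℂ} {u : ℝ → ℝ → ℂ}

lemma ut_eq (sol : SchwartzSolution c₂ c₁ c₀ α lam u) {t : ℝ} (ht : 0 < t) (x : ℝ) :
    sol.ut t x = -Complex.I * c₂ * sol.uxx t x + c₁ * sol.ux t x + Complex.I * c₀ * u t x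
      + Complex.I * lam * ((‖u t x‖ ^ α : ℝ) * u t x) := by
  linear_combination Complex.I * sol.heq t ht x + (sol.ut t x - c₁ * sol.ux t x) * Complex.I_sq

/-- A solution stays at least as close to its Galilean boosts as it is initially. -/
lemma eLpNorm_galilean_sub_le (sol : SchwartzSolution c₂ c₁ c₀ α lam u) (hα : 0 < α)
    (hlam : α * |lam.re| / (2 * √(α + 1)) ≤ lam.im) (h : ℝ) {t : ℝ} (ht : 0 ≤ t) :
    eLpNorm (fun x => galileanPhase c₂ c₁ h t x * u t (x + 2 * c₂ * h * t) - u t x) 2 volume ≤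
      eLpNorm (fun x => galileanPhase c₂ c₁ h 0 x * u 0 (x + 2 * c₂ * h * 0) - u 0 x) 2 volume := by
  have hw := (sol.decayingClassical.galilean c₂ c₁ h).sub sol.decayingClassical
  have hcont₀ := hw.continuous (le_refl 0)
  have hint₀ := hw.integrable_norm_sq (le_refl 0)
  refine eLpNorm_two_le_of_integral_norm_sq_le (hw.continuous ht)
    hcont₀ (hw.integrable_norm_sq ht) hint₀ (hw.integral_norm_sq_le c₂ c₁ c₀ (fun s hs x => ?_) ht)
  have hdiss := inner_power_nonlinearity_nonpos hα hlam
    (galileanPhase c₂ c₁ h s x * u s (x + 2 * c₂ * h * s)) (u s x)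
  rw [norm_mul, norm_galileanPhase, one_mul] at hdiss
  convert hdiss using 2
  rw [sol.ut_eq hs, sol.ut_eq hs]
  push_cast
  linear_combination galileanPhase c₂ c₁ h s x *
    (2 * c₂ * h * sol.ux s (x + 2 * c₂ * h * s)) * Complex.I_sq

/-- The generator of the Galilean boosts at `h = 0` is `i 𝓛`. -/
lemma hasDerivAt_galilean_parameter (sol : SchwartzSolution c₂ c₁ c₀ α lam u) {t : ℝ}
    (ht : 0 ≤ t) (x : ℝ) :
    HasDerivAt (fun h => galileanPhase c₂ c₁ h t x * u t (x + 2 * c₂ * h * t))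
      (Complex.I * (((x : ℂ) + (c₁ : ℂ) * (t : ℂ)) * u t x
            - 2 * Complex.I * (c₂ : ℂ) * (t : ℂ) * deriv (fun y => u t y) x)) 0 := by
  have hline : HasDerivAt (fun h : ℝ => x + 2 * c₂ * h * t) (2 * c₂ * t) 0 := by
    simpa using (((hasDerivAt_id (0 : ℝ)).const_mul (2 * c₂)).mul_const t).const_add x
  have hux : HasDerivAt (u t) (sol.ux t x) (x + 2 * c₂ * 0 * t) := by
    simpa using sol.hux t ht x
  refine ((hasDerivAt_galileanPhase_parameter c₂ c₁ t x).mul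
    (hux.scomp (0 : ℝ) hline)).congr_deriv ?_
  rw [(sol.hux t ht x).deriv]
  simp [galileanPhase]
  linear_combination 2 * c₂ * t * sol.ux t x * Complex.I_sq

end SchwartzSolution

/-- Under the large-dissipation condition `λ₂ ≥ α|λ₁|/(2√(α+1))`,
`‖(𝓛u)(t,·)‖_{L²} ≤ ‖x u₀‖_{L²}` for all `t ≥ 0`, where
`(𝓛u)(t,x) = (x + c₁ t) u(t,x) − 2 i c₂ t ∂_x u(t,x)`. -/
theorem L2_bound_vector_field (c₂ c₁ c₀ α : ℝ) (hc₂ : 0 < c₂) (hα : 0 < α)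
    (lam : ℂ) (hlam : α * |lam.re| / (2 * Real.sqrt (α + 1)) ≤ lam.im)
    (u : ℝ → ℝ → ℂ) (u₀ : ℝ → ℂ)
    (sol : SchwartzSolution c₂ c₁ c₀ α lam u)
    (hinit : ∀ x : ℝ, u 0 x = u₀ x) :
    ∀ t : ℝ, 0 ≤ t →
      eLpNorm (fun x : ℝ =>
          ((x : ℂ) + (c₁ : ℂ) * (t : ℂ)) * u t x
            - 2 * Complex.I * (c₂ : ℂ) * (t : ℂ) * deriv (fun y => u t y) x) 2 volume ≤
        eLpNorm (fun x : ℝ => (x : ℂ) * u₀ x) 2 volume := by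
  intro t ht
  set f : ℝ → ℝ → ℂ := fun h x =>
    galileanPhase c₂ c₁ h t x * u t (x + 2 * c₂ * h * t) - u t x with hf
  have hu : Continuous (u t) := continuous_slice sol.hu_cont ht
  have hfcont : ∀ h, Continuous (f h) := by
    intro h
    simp only [hf, galileanPhase]
    fun_prop
  have hbound : ∀ h : ℝ, eLpNorm (h⁻¹ • f h) 2 volume ≤
      eLpNorm (fun x : ℝ => (x : ℂ) * u₀ x) 2 volume := by
    intro h
    calc eLpNorm (h⁻¹ • f h) 2 volume
        ≤ eLpNorm (h⁻¹ • fun x => galileanPhase c₂ c₁ h 0 x * u 0 (x + 2 * c₂ * h * 0) - u 0 x)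
            2 volume := by
          rw [eLpNorm_const_smul, eLpNorm_const_smul]
          gcongr
          exact sol.eLpNorm_galilean_sub_le hα hlam h ht
      _ ≤ _ := by
          refine eLpNorm_mono fun x => ?_
          have hphase : ‖galileanPhase c₂ c₁ h 0 x - 1‖ ≤ |h| * |x| := by
            rw [← abs_mul, ← Real.norm_eq_abs]
            simpa [galileanPhase, mul_comm] using
              Real.norm_exp_I_mul_ofReal_sub_one_le (x := h * x)
          have e : galileanPhase c₂ c₁ h 0 x * u 0 (x + 2 * c₂ * h * 0) - u 0 x =
              (galileanPhase c₂ c₁ h 0 x - 1) * u₀ x := by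
            rw [mul_zero, add_zero, hinit]
            ring
          rw [Pi.smul_apply, e, norm_smul, norm_mul, norm_mul, Complex.norm_real, norm_inv,
            Real.norm_eq_abs, Real.norm_eq_abs, ← mul_assoc]
          gcongr
          rcases eq_or_ne h 0 with rfl | hh
          · simp
          · rwa [inv_mul_le_iff₀ (abs_pos.2 hh)]
  set a : ℕ → ℝ := fun n => 1 / ((n : ℝ) + 1)
  have ha : Filter.Tendsto a Filter.atTop (nhdsWithin 0 {0}ᶜ) :=
    tendsto_nhdsWithin_iff.2 ⟨tendsto_one_div_add_atTop_nhds_zero_nat,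
      Filter.Eventually.of_forall fun n => (Nat.one_div_pos_of_nat (α := ℝ)).ne'⟩
  have hlim := Lp.eLpNorm_lim_le_liminf_eLpNorm (p := 2) (μ := volume)
    (f := fun n => (a n)⁻¹ • f (a n))
    (fun n => ((hfcont _).const_smul _).aestronglyMeasurable) _
    (Filter.Eventually.of_forall fun x => by
      have := (sol.hasDerivAt_galilean_parameter ht x).tendsto_slope_zero.comp ha
      simpa [Function.comp_def, hf, galileanPhase] using this)
  calc _ = _ := eLpNorm_congr_norm_ae (Filter.Eventually.of_forall fun x => by
        rw [norm_mul Complex.I, Complex.norm_I, one_mul])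
    _ ≤ _ := hlim
    _ ≤ Filter.liminf (fun _ : ℕ => eLpNorm (fun x : ℝ => (x : ℂ) * u₀ x) 2 volume)
          Filter.atTop :=
        Filter.liminf_le_liminf (Filter.Eventually.of_forall fun n => hbound (a n))
    _ = _ := Filter.liminf_const _

end
end

section
/- Let 1 ≤ α < 2 and λ = λ₁ + iλ₂ with λ₂ ≥ α|λ₁|/(2√(α+1)), and let u be a Schwartz-class classical solution of equation (1.1) on [0,∞) with initial datum u₀. Then there exists a constant C > 0, depending only on α, λ and c₂, such that for all t ≥ 0, ‖(𝓛²u)(t,·)‖_{L²(ℝ)} ≤ C ( ‖u₀‖_{L²} + ‖x² u₀‖_{L²} + ( ‖u₀‖_{L²} + ‖x u₀‖_{L²} )^{2α+1} t^{2−α} ), where 𝓛²u = 𝓛(𝓛u). -/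
open MeasureTheory Real Set

noncomputable section

/-- The vector field `𝓛`: `(𝓛 u)(t,x) = (x + c₁ t) u(t,x) − 2 i c₂ t ∂_x u(t,x)`. -/
def Lop (c₂ c₁ : ℝ) (u : ℝ → ℝ → ℂ) : ℝ → ℝ → ℂ := fun t x =>
  ((x : ℂ) + (c₁ : ℂ) * (t : ℂ)) * u t x
    - 2 * Complex.I * (c₂ : ℂ) * (t : ℂ) * deriv (fun y => u t y) x

open Filter Topology ComplexConjugate

/-- The power nonlinearity `z ↦ |z|^α z`. -/
def powNL (α : ℝ) (z : ℂ) : ℂ := ((‖z‖ ^ α : ℝ) : ℂ) * z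

/-- The real derivative of `powNL α` at `z` in the direction `w`. -/
def powNLDeriv (α : ℝ) (z w : ℂ) : ℂ :=
  ((‖z‖ ^ α : ℝ) : ℂ) * (w + ((α * (z / ‖z‖ * conj w).re : ℝ) : ℂ) * (z / ‖z‖))

theorem norm_div_norm_le_one (z : ℂ) : ‖z / (‖z‖ : ℂ)‖ ≤ 1 := by
  rw [norm_div, Complex.norm_real, norm_norm]
  exact div_self_le_one _

theorem dissipation_quadratic_form {α : ℝ} (hα : 0 ≤ α) {lam : ℂ}
    (hlam : α * |lam.re| / (2 * √(α + 1)) ≤ lam.im) (p q : ℝ) :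
    0 ≤ lam.im * (1 + α) * p ^ 2 + α * lam.re * (p * q) + lam.im * q ^ 2 := by
  have hs : 0 < √(α + 1) := Real.sqrt_pos.2 (by linarith)
  have hsq : √(α + 1) ^ 2 = α + 1 := Real.sq_sqrt (by linarith)
  have h1 : α * |lam.re| ≤ lam.im * (2 * √(α + 1)) := (div_le_iff₀ (by positivity)).1 hlam
  have him : 0 ≤ lam.im := le_trans (by positivity) hlam
  have h2 : -(α * lam.re * (p * q)) ≤ lam.im * (2 * √(α + 1)) * (|p| * |q|) := by
    calc -(α * lam.re * (p * q)) ≤ |α * lam.re * (p * q)| := neg_le_abs _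
      _ = α * |lam.re| * (|p| * |q|) := by rw [abs_mul, abs_mul, abs_mul, abs_of_nonneg hα]
      _ ≤ _ := by gcongr
  have h3 : 0 ≤ lam.im * (√(α + 1) * |p| - |q|) ^ 2 := by positivity
  have h4 : lam.im * (√(α + 1) * |p| - |q|) ^ 2 =
      lam.im * (1 + α) * p ^ 2 - lam.im * (2 * √(α + 1)) * (|p| * |q|) + lam.im * q ^ 2 := by
    rw [← sq_abs p, ← sq_abs q]
    linear_combination lam.im * |p| ^ 2 * hsq
  linarith

theorem re_powNLDeriv_mul_conj_nonpos {α : ℝ} (hα : 0 < α) {lam : ℂ}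
    (hlam : α * |lam.re| / (2 * √(α + 1)) ≤ lam.im) (z w : ℂ) :
    (Complex.I * lam * powNLDeriv α z w * conj w).re ≤ 0 := by
  rcases eq_or_ne z 0 with rfl | hz
  · simp [powNLDeriv, Real.zero_rpow hα.ne']
  set e : ℂ := z / ‖z‖ with he
  have hne : ‖e‖ = 1 := by
    rw [he, norm_div, Complex.norm_real, norm_norm, div_self (norm_ne_zero_iff.2 hz)]
  have hw : w.re ^ 2 + w.im ^ 2 = (e * conj w).re ^ 2 + (e * conj w).im ^ 2 := by
    have h1 : ‖e * conj w‖ ^ 2 = ‖w‖ ^ 2 := by simp [hne]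
    rw [Complex.sq_norm, Complex.sq_norm, Complex.normSq_apply, Complex.normSq_apply] at h1
    nlinarith
  have hq := dissipation_quadratic_form hα.le hlam (e * conj w).re (e * conj w).im
  have key : (Complex.I * lam * powNLDeriv α z w * conj w).re =
      -(‖z‖ ^ α) * (lam.im * (w.re ^ 2 + w.im ^ 2) + α * (e * conj w).re *
        (lam.im * (e * conj w).re + lam.re * (e * conj w).im)) := by
    rw [powNLDeriv, ← he]
    simp only [Complex.mul_re, Complex.mul_im, Complex.add_re, Complex.add_im, Complex.I_re,
      Complex.I_im, Complex.ofReal_re, Complex.ofReal_im, Complex.conj_re, Complex.conj_im]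
    ring
  rw [key, hw]
  have : 0 ≤ ‖z‖ ^ α := by positivity
  nlinarith

theorem hasDerivAt_powNL_line {α : ℝ} (hα : 0 < α) (b d : ℂ) (s : ℝ) :
    HasDerivAt (fun r : ℝ => powNL α (b + r * d)) (powNLDeriv α (b + s * d) d) s := by
  have hg : HasDerivAt (fun r : ℝ => b + (r : ℂ) * d) d s := by
    simpa using ((Complex.ofRealCLM.hasDerivAt (x := s)).mul_const d).const_add b
  rcases eq_or_ne (b + (s : ℂ) * d) 0 with hz | hz
  · rw [hz, hasDerivAt_iff_tendsto_slope]
    have h0 : powNLDeriv α 0 d = 0 := by simp [powNLDeriv, Real.zero_rpow hα.ne']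
    have hc : Tendsto (fun r : ℝ => ((‖b + (r : ℂ) * d‖ ^ α : ℝ) : ℂ)) (𝓝[≠] s) (𝓝 0) := by
      have : ContinuousAt (fun r : ℝ => ((‖b + (r : ℂ) * d‖ ^ α : ℝ) : ℂ)) s :=
        Complex.continuous_ofReal.continuousAt.comp
          (hg.continuousAt.norm.rpow_const (Or.inr hα.le))
      have h := this.tendsto
      simp only [hz, norm_zero, Real.zero_rpow hα.ne', Complex.ofReal_zero] at h
      exact h.mono_left nhdsWithin_le_nhds
    have hs := hasDerivAt_iff_tendsto_slope.1 hg
    have := hc.mul hs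
    rw [zero_mul] at this
    rw [h0]
    refine this.congr fun r => ?_
    simp only [slope_def_module, powNL, hz, Complex.real_smul]
    simp
    ring
  · have hpos : 0 < ‖b + (s : ℂ) * d‖ := norm_pos_iff.2 hz
    have hn := hg.norm_sq.rpow_const (p := α / 2) (Or.inl (by positivity))
    have hc : ∀ r : ℝ, (‖b + (r : ℂ) * d‖ ^ 2) ^ (α / 2) = ‖b + (r : ℂ) * d‖ ^ α := by
      intro r
      rw [← Real.rpow_natCast, ← Real.rpow_mul (norm_nonneg _)]
      congr 1; push_cast; ring
    simp only [hc] at hn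
    have := hn.ofReal_comp.mul hg
    refine this.congr_deriv ?_
    have hp : (‖b + (s : ℂ) * d‖ ^ 2) ^ (α / 2 - 1) =
        ‖b + (s : ℂ) * d‖ ^ α / ‖b + (s : ℂ) * d‖ ^ 2 := by
      rw [Real.rpow_sub_one (by positivity), hc]
    rw [hp, powNLDeriv]
    set z := b + (s : ℂ) * d
    have hin : inner ℝ z d = (z * conj d).re := by
      rw [Complex.inner, ← Complex.conj_re]; simp
      ring
    have hre : (z / (‖z‖ : ℂ) * conj d).re = (z * conj d).re / ‖z‖ := by
      rw [div_mul_eq_mul_div, Complex.div_ofReal_re]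
    rw [hin, hre]
    have : (‖z‖ : ℂ) ≠ 0 := by exact_mod_cast hpos.ne'
    push_cast
    field_simp
    ring

theorem abs_rpow_sub_rpow_le {α : ℝ} (hα : 1 ≤ α) {S p q : ℝ} (hp : p ∈ Icc 0 S)
    (hq : q ∈ Icc 0 S) : |p ^ α - q ^ α| ≤ α * S ^ (α - 1) * |p - q| := by
  have := (convex_Icc (0 : ℝ) S).norm_image_sub_le_of_norm_hasDerivWithin_le
    (f := fun x : ℝ => x ^ α) (f' := fun x => α * x ^ (α - 1)) (C := α * S ^ (α - 1))
    (fun x hx => (Real.hasDerivAt_rpow_const (Or.inr hα)).hasDerivWithinAt)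
    (fun x hx => by
      rw [Real.norm_of_nonneg (mul_nonneg (by linarith) (Real.rpow_nonneg hx.1 _))]
      exact mul_le_mul_of_nonneg_left (Real.rpow_le_rpow hx.1 hx.2 (by linarith)) (by linarith))
    hq hp
  simpa using this

theorem norm_mul_unit_sub_unit_le (z b : ℂ) :
    ‖z‖ * ‖b / (‖b‖ : ℂ) - z / (‖z‖ : ℂ)‖ ≤ 2 * ‖b - z‖ := by
  have key : ∀ y : ℂ, (‖y‖ : ℂ) * (y / (‖y‖ : ℂ)) = y := by
    intro y
    rcases eq_or_ne y 0 with rfl | hy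
    · simp
    · have : (‖y‖ : ℂ) ≠ 0 := by exact_mod_cast norm_ne_zero_iff.2 hy
      field_simp
  have h1 : (‖z‖ : ℂ) * (b / (‖b‖ : ℂ) - z / (‖z‖ : ℂ)) =
      ((‖z‖ - ‖b‖ : ℝ) : ℂ) * (b / (‖b‖ : ℂ)) + (b - z) := by
    rw [mul_sub, key z]
    push_cast
    rw [sub_mul, key b]; ring
  calc ‖z‖ * ‖b / (‖b‖ : ℂ) - z / (‖z‖ : ℂ)‖
      = ‖(‖z‖ : ℂ) * (b / (‖b‖ : ℂ) - z / (‖z‖ : ℂ))‖ := by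
        rw [norm_mul, Complex.norm_real, norm_norm]
    _ = ‖((‖z‖ - ‖b‖ : ℝ) : ℂ) * (b / (‖b‖ : ℂ)) + (b - z)‖ := by rw [h1]
    _ ≤ ‖b - z‖ * 1 + ‖b - z‖ := by
        refine (norm_add_le _ _).trans (add_le_add_left ?_ _)
        rw [norm_mul, Complex.norm_real, Real.norm_eq_abs]
        refine mul_le_mul ?_ (norm_div_norm_le_one b) (norm_nonneg _) (norm_nonneg _)
        rw [norm_sub_rev]; exact abs_norm_sub_norm_le z b
    _ = 2 * ‖b - z‖ := by ring

theorem norm_powNLDeriv_sub_le {α : ℝ} (hα : 1 ≤ α) {S : ℝ} {z b : ℂ} (hz : ‖z‖ ≤ S)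
    (hb : ‖b‖ ≤ S) (w : ℂ) :
    ‖powNLDeriv α z w - powNLDeriv α b w‖ ≤
      (α ^ 2 + 5 * α) * S ^ (α - 1) * ‖z - b‖ * ‖w‖ := by
  set e := z / (‖z‖ : ℂ) with he
  set f := b / (‖b‖ : ℂ) with hf
  have he1 : ‖e‖ ≤ 1 := norm_div_norm_le_one z
  have hf1 : ‖f‖ ≤ 1 := norm_div_norm_le_one b
  have hS : 0 ≤ S := (norm_nonneg _).trans hz
  have hre : ∀ g : ℂ, |(g * conj w).re| ≤ ‖g‖ * ‖w‖ := fun g =>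
    (Complex.abs_re_le_norm _).trans (by simp)
  have hsplit : powNLDeriv α z w - powNLDeriv α b w =
      ((‖z‖ ^ α - ‖b‖ ^ α : ℝ) : ℂ) * (w + ((α * (f * conj w).re : ℝ) : ℂ) * f)
      + ((‖z‖ ^ α : ℝ) : ℂ) * (α : ℂ) * (((((e - f) * conj w).re : ℝ) : ℂ) * e
        + (((f * conj w).re : ℝ) : ℂ) * (e - f)) := by
    simp only [powNLDeriv, ← he, ← hf, sub_mul, Complex.sub_re]
    push_cast; ring
  have hA : ‖w + ((α * (f * conj w).re : ℝ) : ℂ) * f‖ ≤ (1 + α) * ‖w‖ := by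
    refine (norm_add_le _ _).trans ?_
    rw [norm_mul, Complex.norm_real, Real.norm_eq_abs, abs_mul, abs_of_nonneg (by linarith : 0 ≤ α)]
    have : |(f * conj w).re| * ‖f‖ ≤ ‖w‖ * 1 :=
      mul_le_mul ((hre f).trans (mul_le_of_le_one_left (norm_nonneg _) hf1)) hf1
        (norm_nonneg _) (norm_nonneg _)
    nlinarith
  have hB : ‖((((e - f) * conj w).re : ℝ) : ℂ) * e + (((f * conj w).re : ℝ) : ℂ) * (e - f)‖
      ≤ 2 * ‖e - f‖ * ‖w‖ := by
    refine (norm_add_le _ _).trans ?_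
    rw [norm_mul, norm_mul, Complex.norm_real, Complex.norm_real, Real.norm_eq_abs,
      Real.norm_eq_abs]
    have h1 : |((e - f) * conj w).re| * ‖e‖ ≤ (‖e - f‖ * ‖w‖) * 1 :=
      mul_le_mul (hre _) he1 (norm_nonneg _) (by positivity)
    have h2 : |(f * conj w).re| * ‖e - f‖ ≤ ‖w‖ * ‖e - f‖ :=
      mul_le_mul_of_nonneg_right ((hre f).trans (mul_le_of_le_one_left (norm_nonneg _) hf1))
        (norm_nonneg _)
    linarith
  have hzp : ‖z‖ ^ α * ‖e - f‖ ≤ S ^ (α - 1) * (2 * ‖z - b‖) := by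
    have h1 : ‖z‖ ^ α = ‖z‖ ^ (α - 1) * ‖z‖ := by
      rcases eq_or_ne z 0 with rfl | hz0
      · simp [Real.zero_rpow (by linarith : α ≠ 0)]
      · rw [Real.rpow_sub_one (norm_ne_zero_iff.2 hz0)]
        field_simp
    rw [h1, mul_assoc]
    refine mul_le_mul (Real.rpow_le_rpow (norm_nonneg _) hz (by linarith)) ?_ (by positivity)
      (by positivity)
    have := norm_mul_unit_sub_unit_le z b
    rwa [norm_sub_rev, norm_sub_rev b z] at this
  have hr := abs_rpow_sub_rpow_le hα ⟨norm_nonneg z, hz⟩ ⟨norm_nonneg b, hb⟩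
  have hr' : |‖z‖ ^ α - ‖b‖ ^ α| ≤ α * S ^ (α - 1) * ‖z - b‖ :=
    hr.trans (mul_le_mul_of_nonneg_left (abs_norm_sub_norm_le z b) (by positivity))
  rw [hsplit]
  refine (norm_add_le _ _).trans ?_
  rw [norm_mul, norm_mul, norm_mul, Complex.norm_real, Complex.norm_real, Complex.norm_real,
    Real.norm_eq_abs, Real.norm_eq_abs, Real.norm_eq_abs,
    abs_of_nonneg (by linarith : 0 ≤ α), abs_of_nonneg (by positivity : 0 ≤ ‖z‖ ^ α)]
  calc _ ≤ (α * S ^ (α - 1) * ‖z - b‖) * ((1 + α) * ‖w‖)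
        + ‖z‖ ^ α * α * (2 * ‖e - f‖ * ‖w‖) := by gcongr
    _ = (α * S ^ (α - 1) * ‖z - b‖) * ((1 + α) * ‖w‖)
        + (‖z‖ ^ α * ‖e - f‖) * (2 * α * ‖w‖) := by ring
    _ ≤ (α * S ^ (α - 1) * ‖z - b‖) * ((1 + α) * ‖w‖)
        + (S ^ (α - 1) * (2 * ‖z - b‖)) * (2 * α * ‖w‖) := by gcongr
    _ = _ := by ring

theorem norm_powNL_taylor_le {α : ℝ} (hα : 1 ≤ α) {S : ℝ} {a b : ℂ} (ha : ‖a‖ ≤ S)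
    (hb : ‖b‖ ≤ S) :
    ‖powNL α a - powNL α b - powNLDeriv α b (a - b)‖ ≤
      (α ^ 2 + 5 * α) * S ^ (α - 1) * ‖a - b‖ ^ 2 := by
  have hd : ∀ s : ℝ, HasDerivAt
      (fun r : ℝ => powNL α (b + r * (a - b)) - (r : ℂ) * powNLDeriv α b (a - b))
      (powNLDeriv α (b + s * (a - b)) (a - b) - powNLDeriv α b (a - b)) s := by
    intro s
    have h := (Complex.ofRealCLM.hasDerivAt (x := s)).mul_const (powNLDeriv α b (a - b))
    simpa using (hasDerivAt_powNL_line (by linarith : 0 < α) b (a - b) s).fun_sub h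
  have hS : 0 ≤ S := (norm_nonneg _).trans ha
  have := norm_image_sub_le_of_norm_deriv_le_segment_01' (fun s _ => (hd s).hasDerivWithinAt)
    (C := (α ^ 2 + 5 * α) * S ^ (α - 1) * ‖a - b‖ ^ 2) (fun s hs => by
      have hseg : ‖b + (s : ℂ) * (a - b)‖ ≤ S := by
        have h1 : b + (s : ℂ) * (a - b) = ((1 - s : ℝ) : ℂ) * b + (s : ℂ) * a := by
          push_cast; ring
        rw [h1]
        refine (norm_add_le _ _).trans ?_
        rw [norm_mul, norm_mul, Complex.norm_real, Complex.norm_real,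
          Real.norm_of_nonneg (by linarith [hs.2] : 0 ≤ 1 - s), Real.norm_of_nonneg hs.1]
        nlinarith [hs.1, hs.2]
      refine (norm_powNLDeriv_sub_le hα hseg hb (a - b)).trans ?_
      have h2 : ‖b + (s : ℂ) * (a - b) - b‖ ≤ ‖a - b‖ := by
        rw [add_sub_cancel_left, norm_mul, Complex.norm_real, Real.norm_of_nonneg hs.1]
        exact mul_le_of_le_one_left (norm_nonneg _) hs.2.le
      rw [sq ‖a - b‖, ← mul_assoc]
      gcongr)
  have e : powNL α (b + ((1 : ℝ) : ℂ) * (a - b)) - ((1 : ℝ) : ℂ) * powNLDeriv α b (a - b) -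
      (powNL α (b + ((0 : ℝ) : ℂ) * (a - b)) - ((0 : ℝ) : ℂ) * powNLDeriv α b (a - b)) =
      powNL α a - powNL α b - powNLDeriv α b (a - b) := by
    simp; ring
  rwa [e] at this

theorem re_powNL_sub_mul_conj_nonpos {α : ℝ} (hα : 0 < α) {lam : ℂ}
    (hlam : α * |lam.re| / (2 * √(α + 1)) ≤ lam.im) (a b : ℂ) :
    (Complex.I * lam * (powNL α a - powNL α b) * conj (a - b)).re ≤ 0 := by
  have hd : ∀ s : ℝ, HasDerivAt
      (fun r : ℝ => (Complex.I * lam * powNL α (b + r * (a - b)) * conj (a - b)).re)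
      (Complex.I * lam * powNLDeriv α (b + s * (a - b)) (a - b) * conj (a - b)).re s := by
    intro s
    have h := ((hasDerivAt_powNL_line hα b (a - b) s).const_mul (Complex.I * lam)).mul_const
      (conj (a - b))
    exact Complex.reCLM.hasFDerivAt.comp_hasDerivAt s h
  have hanti := antitone_of_deriv_nonpos (fun s => (hd s).differentiableAt)
    (fun s => by rw [(hd s).deriv]; exact re_powNLDeriv_mul_conj_nonpos hα hlam _ _)
  have := hanti zero_le_one
  simp only [Complex.ofReal_one, Complex.ofReal_zero, one_mul, zero_mul, add_zero,
    add_sub_cancel] at this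
  rw [mul_sub, sub_mul, Complex.sub_re]
  linarith

/-- Continuous functions of order `O(1 / (1 + x²))`. -/
def QuadDecay (f : ℝ → ℂ) : Prop :=
  Continuous f ∧ ∃ C, ∀ x, ‖f x‖ ≤ C * (1 + x ^ 2)⁻¹

namespace QuadDecay

variable {f g : ℝ → ℂ}

theorem exists_bound (hf : QuadDecay f) : ∃ C, 0 ≤ C ∧ ∀ x, ‖f x‖ ≤ C * (1 + x ^ 2)⁻¹ := by
  obtain ⟨C, hC⟩ := hf.2
  refine ⟨C, ?_, hC⟩
  have := (norm_nonneg _).trans (hC 0)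
  simpa using this

theorem norm_mul_bound (hf : QuadDecay f) (hg : QuadDecay g) :
    ∃ C, ∀ x, ‖f x‖ * ‖g x‖ ≤ C * (1 + x ^ 2)⁻¹ := by
  obtain ⟨C, hC0, hC⟩ := hf.exists_bound
  obtain ⟨D, hD0, hD⟩ := hg.exists_bound
  refine ⟨C * D, fun x => ?_⟩
  have h1 : (1 + x ^ 2)⁻¹ ≤ 1 := inv_le_one_of_one_le₀ (by nlinarith)
  have h2 : ‖g x‖ ≤ D := (hD x).trans (mul_le_of_le_one_right hD0 h1)
  calc ‖f x‖ * ‖g x‖ ≤ C * (1 + x ^ 2)⁻¹ * D :=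
        mul_le_mul (hC x) h2 (norm_nonneg _) (by positivity)
    _ = _ := by ring

theorem integrable_norm_mul (hf : QuadDecay f) (hg : QuadDecay g) :
    Integrable fun x => ‖f x‖ * ‖g x‖ := by
  obtain ⟨C, hC⟩ := hf.norm_mul_bound hg
  refine (integrable_inv_one_add_sq.const_mul C).mono'
    (hf.1.norm.mul hg.1.norm).aestronglyMeasurable (ae_of_all _ fun x => ?_)
  rw [Real.norm_of_nonneg (by positivity)]
  exact hC x

theorem integrable_of_abs_le (hf : QuadDecay f) (hg : QuadDecay g) {F : ℝ → ℝ}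
    (hF : Continuous F) (c : ℝ) (h : ∀ x, |F x| ≤ c * (‖f x‖ * ‖g x‖)) : Integrable F :=
  ((hf.integrable_norm_mul hg).const_mul c).mono' hF.aestronglyMeasurable
    (ae_of_all _ fun x => h x)

theorem integrable_norm_sq (hf : QuadDecay f) : Integrable fun x => ‖f x‖ ^ 2 := by
  simpa only [sq] using hf.integrable_norm_mul hf

theorem integrable_inner (hf : QuadDecay f) (hg : QuadDecay g) :
    Integrable fun x => inner ℝ (f x) (g x) :=
  hf.integrable_of_abs_le hg (hf.1.inner hg.1) 1
    (fun x => by rw [one_mul]; exact abs_real_inner_le_norm _ _)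

theorem memLp_two (hf : QuadDecay f) : MemLp (fun x => ‖f x‖) 2 := by
  rw [memLp_two_iff_integrable_sq hf.1.norm.aestronglyMeasurable]
  exact hf.integrable_norm_sq

theorem integral_norm_mul_le (hf : QuadDecay f) (hg : QuadDecay g) :
    ∫ x, ‖f x‖ * ‖g x‖ ≤ √(∫ x, ‖f x‖ ^ 2) * √(∫ x, ‖g x‖ ^ 2) := by
  have h := integral_mul_le_Lp_mul_Lq_of_nonneg (μ := volume) Real.HolderConjugate.two_two
    (ae_of_all _ fun x => norm_nonneg (f x)) (ae_of_all _ fun x => norm_nonneg (g x))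
    (by simpa using hf.memLp_two) (by simpa using hg.memLp_two)
  simpa [Real.sqrt_eq_rpow] using h

theorem tendsto_zero (hf : QuadDecay f) {l : Filter ℝ}
    (hl : Tendsto (fun x : ℝ => x ^ 2) l atTop) : Tendsto f l (𝓝 0) := by
  obtain ⟨C, hC⟩ := hf.2
  refine squeeze_zero_norm hC ?_
  have : Tendsto (fun x : ℝ => (1 + x ^ 2)⁻¹) l (𝓝 0) :=
    (tendsto_atTop_add_const_left _ 1 hl).inv_tendsto_atTop
  simpa using this.const_mul C

theorem tendsto_atTop (hf : QuadDecay f) : Tendsto f atTop (𝓝 0) :=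
  hf.tendsto_zero (tendsto_pow_atTop two_ne_zero)

theorem tendsto_atBot (hf : QuadDecay f) : Tendsto f atBot (𝓝 0) :=
  hf.tendsto_zero (by
    simpa [Function.comp_def] using
      (tendsto_pow_atTop (α := ℝ) two_ne_zero).comp (tendsto_abs_atBot_atTop (G := ℝ)))

theorem add (hf : QuadDecay f) (hg : QuadDecay g) : QuadDecay fun x => f x + g x := by
  obtain ⟨C, hC⟩ := hf.2
  obtain ⟨D, hD⟩ := hg.2
  refine ⟨hf.1.add hg.1, C + D, fun x => ?_⟩
  rw [add_mul]
  exact (norm_add_le _ _).trans (add_le_add (hC x) (hD x))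

theorem const_mul (hf : QuadDecay f) (c : ℂ) : QuadDecay fun x => c * f x := by
  obtain ⟨C, hC⟩ := hf.2
  refine ⟨continuous_const.mul hf.1, ‖c‖ * C, fun x => ?_⟩
  rw [norm_mul, mul_assoc]
  exact mul_le_mul_of_nonneg_left (hC x) (norm_nonneg _)

theorem norm_sq_le {f' : ℝ → ℂ} {κ : ℝ} (hκ : 0 < κ) {r : ℝ → ℝ} (hf : QuadDecay f)
    (hf' : QuadDecay f') (hg : QuadDecay g) (hd : ∀ x, HasDerivAt f (f' x) x)
    (hgf : ∀ x, g x = (r x : ℂ) * f x - Complex.I * κ * f' x) (x : ℝ) :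
    ‖f x‖ ^ 2 ≤ 2 / κ * (√(∫ x, ‖f x‖ ^ 2) * √(∫ x, ‖g x‖ ^ 2)) := by
  have hint : Integrable fun y => 2 * inner ℝ (f y) (f' y) :=
    (hf.integrable_inner hf').const_mul 2
  have hlim : Tendsto (fun y => ‖f y‖ ^ 2) atBot (𝓝 0) := by
    simpa using hf.tendsto_atBot.norm.pow 2
  have h := integral_Iic_of_hasDerivAt_of_tendsto' (a := x)
    (fun y _ => (hd y).norm_sq) hint.integrableOn hlim
  rw [sub_zero] at h
  rw [← h]
  have hpt : ∀ y, 2 * inner ℝ (f y) (f' y) ≤ 2 / κ * (‖f y‖ * ‖g y‖) := by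
    intro y
    have h1 : κ * inner ℝ (f y) (f' y) = (Complex.I * (conj (f y) * g y)).re := by
      rw [Complex.inner, hgf y]
      simp only [Complex.mul_re, Complex.mul_im, Complex.sub_re, Complex.sub_im, Complex.I_re,
        Complex.I_im, Complex.ofReal_re, Complex.ofReal_im, Complex.conj_re, Complex.conj_im]
      ring
    have h2 : κ * inner ℝ (f y) (f' y) ≤ ‖f y‖ * ‖g y‖ := by
      rw [h1]; refine (Complex.re_le_norm _).trans (by simp)
    rw [div_mul_eq_mul_div, le_div_iff₀ hκ]
    linarith
  calc ∫ y in Iic x, 2 * inner ℝ (f y) (f' y)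
      ≤ ∫ y in Iic x, 2 / κ * (‖f y‖ * ‖g y‖) :=
        integral_mono hint.integrableOn
          ((hf.integrable_norm_mul hg).const_mul _).integrableOn hpt
    _ ≤ ∫ y, 2 / κ * (‖f y‖ * ‖g y‖) :=
        setIntegral_le_integral ((hf.integrable_norm_mul hg).const_mul _)
          (ae_of_all _ fun y => by positivity)
    _ ≤ _ := by
        rw [integral_const_mul]
        exact mul_le_mul_of_nonneg_left (hf.integral_norm_mul_le hg) (by positivity)

theorem integral_norm_sq_le_of_tendsto {ι : Type*} {l : Filter ι} [l.NeBot]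
    [l.IsCountablyGenerated] {F : ι → ℝ → ℂ} (hF : ∀ i, QuadDecay (F i)) (hg : QuadDecay g)
    (hlim : ∀ x, Tendsto (fun i => F i x) l (𝓝 (g x))) {M : ℝ}
    (hM : ∀ᶠ i in l, ∫ x, ‖F i x‖ ^ 2 ≤ M) : ∫ x, ‖g x‖ ^ 2 ≤ M := by
  have hM0 : 0 ≤ M := by
    obtain ⟨i, hi⟩ := hM.exists
    exact (integral_nonneg fun x => by positivity).trans hi
  have hl : ∀ f : ℝ → ℂ, QuadDecay f →
      ∫⁻ x, ENNReal.ofReal (‖f x‖ ^ 2) = ENNReal.ofReal (∫ x, ‖f x‖ ^ 2) := fun f hf =>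
    (ofReal_integral_eq_lintegral_ofReal hf.integrable_norm_sq
      (ae_of_all _ fun x => by positivity)).symm
  rw [← ENNReal.ofReal_le_ofReal_iff hM0, ← hl g hg]
  calc ∫⁻ x, ENNReal.ofReal (‖g x‖ ^ 2)
      = ∫⁻ x, liminf (fun i => ENNReal.ofReal (‖F i x‖ ^ 2)) l := by
        refine lintegral_congr fun x => ?_
        exact (((ENNReal.continuous_ofReal.tendsto _).comp
          ((hlim x).norm.pow 2)).liminf_eq).symm
    _ ≤ liminf (fun i => ∫⁻ x, ENNReal.ofReal (‖F i x‖ ^ 2)) l :=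
        lintegral_liminf_le fun i =>
          ((hF i).1.norm.measurable.pow_const 2).ennreal_ofReal
    _ ≤ liminf (fun _ => ENNReal.ofReal M) l := by
        refine liminf_le_liminf ?_
        filter_upwards [hM] with i hi
        rw [hl _ (hF i)]
        exact ENNReal.ofReal_le_ofReal hi
    _ = ENNReal.ofReal M := liminf_const _

end QuadDecay

theorem sqrt_le_of_deriv_le_mul_sqrt {E E' : ℝ → ℝ} {T A θ : ℝ} (hθ : θ < 1) (hE : ∀ t, 0 ≤ E t)
    (hc : ContinuousOn E (Icc 0 T)) (hd : ∀ t ∈ Ioo 0 T, HasDerivAt E (E' t) t) (hA : 0 ≤ A)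
    (hE' : ∀ t ∈ Ioo 0 T, E' t ≤ 2 * (A * t ^ (-θ)) * √(E t)) {t : ℝ} (ht : t ∈ Icc 0 T) :
    √(E t) ≤ √(E 0) + A / (1 - θ) * t ^ (1 - θ) := by
  refine le_of_forall_pos_le_add fun δ hδ => ?_
  have hpos : ∀ s, 0 < E s + δ ^ 2 := fun s => by have := hE s; positivity
  have hderiv : ∀ s ∈ Ioo 0 T, HasDerivAt
      (fun s => √(E s + δ ^ 2) - A / (1 - θ) * s ^ (1 - θ))
      (E' s / (2 * √(E s + δ ^ 2)) - A / (1 - θ) * ((1 - θ) * s ^ (1 - θ - 1))) s := fun s hs =>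
    (((hd s hs).add_const _).sqrt (hpos s).ne').sub
      ((Real.hasDerivAt_rpow_const (Or.inl hs.1.ne')).const_mul _)
  have hanti : AntitoneOn (fun s => √(E s + δ ^ 2) - A / (1 - θ) * s ^ (1 - θ)) (Icc 0 T) := by
    refine antitoneOn_of_deriv_nonpos (convex_Icc 0 T) ?_ ?_ ?_
    · exact (hc.add continuousOn_const).sqrt.sub
        (continuousOn_const.mul (continuousOn_id.rpow_const fun s _ => Or.inr (by linarith)))
    · rw [interior_Icc]
      exact fun s hs => (hderiv s hs).differentiableAt.differentiableWithinAt
    · rw [interior_Icc]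
      intro s hs
      rw [(hderiv s hs).deriv]
      have h1 : A / (1 - θ) * ((1 - θ) * s ^ (1 - θ - 1)) = A * s ^ (-θ) := by
        have : (1 - θ) ≠ 0 := by linarith
        rw [show (1 - θ - 1 : ℝ) = -θ by ring]
        field_simp
      have hsq : 0 < √(E s + δ ^ 2) := Real.sqrt_pos.2 (hpos s)
      rw [h1, sub_nonpos, div_le_iff₀ (by positivity)]
      have h2 : √(E s) ≤ √(E s + δ ^ 2) := Real.sqrt_le_sqrt (by nlinarith)
      have h3 : 0 ≤ 2 * (A * s ^ (-θ)) := by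
        have := Real.rpow_nonneg hs.1.le (-θ)
        positivity
      nlinarith [hE' s hs, mul_le_mul_of_nonneg_left h2 h3]
  have h := hanti (left_mem_Icc.2 (ht.1.trans ht.2)) ht ht.1
  simp only [Real.zero_rpow (by linarith : 1 - θ ≠ 0), mul_zero, sub_zero] at h
  have h1 : √(E t) ≤ √(E t + δ ^ 2) := Real.sqrt_le_sqrt (by nlinarith)
  have h2 : √(E 0 + δ ^ 2) ≤ √(E 0) + δ := by
    rw [Real.sqrt_le_left (by positivity)]
    nlinarith [Real.sq_sqrt (hE 0), Real.sqrt_nonneg (E 0)]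
  linarith

theorem tendsto_second_difference {h h' : ℝ → ℂ} {h'' : ℂ} (hd : ∀ s, HasDerivAt h (h' s) s)
    (hd' : HasDerivAt h' h'' 0) :
    Tendsto (fun ε : ℝ => ((ε : ℂ) ^ 2)⁻¹ * (h ε - 2 * h 0 + h (-ε))) (𝓝[>] 0) (𝓝 h'') := by
  rw [Metric.tendsto_nhds]
  intro η hη
  have hlo := (hasDerivAt_iff_isLittleO.1 hd').def (by positivity : (0 : ℝ) < η / 4)
  obtain ⟨δ, hδ, hball⟩ := Metric.eventually_nhds_iff.1 hlo
  have hmem : Ioo (0 : ℝ) δ ∈ 𝓝[>] (0 : ℝ) := Ioo_mem_nhdsGT hδ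
  filter_upwards [hmem] with ε hε
  have hder : ∀ s : ℝ, HasDerivAt (fun s : ℝ => h s + h (-s) - (s : ℂ) ^ 2 * h'')
      (h' s + -h' (-s) - 2 * s * h'') s := by
    intro s
    have h1 : HasDerivAt (fun s : ℝ => h (-s)) (-h' (-s)) s := by
      simpa [Function.comp_def] using (hd (-s)).scomp s (hasDerivAt_neg s)
    have h2 : HasDerivAt (fun s : ℝ => (s : ℂ) ^ 2 * h'') (2 * s * h'') s := by
      simpa using ((Complex.ofRealCLM.hasDerivAt (x := s)).fun_pow 2).mul_const h''
    exact ((hd s).fun_add h1).fun_sub h2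
  have hbd : ∀ s ∈ Ico 0 ε, ‖h' s + -h' (-s) - 2 * s * h''‖ ≤ η / 2 * ε := by
    intro s hs
    have hsδ : |s| < δ := by rw [abs_of_nonneg hs.1]; exact hs.2.trans hε.2
    have e1 := hball (y := s) (by simpa using hsδ)
    have e2 := hball (y := -s) (by simpa using hsδ)
    simp only [sub_zero, norm_neg, Complex.real_smul, Real.norm_eq_abs, abs_of_nonneg hs.1] at e1 e2
    have : h' s + -h' (-s) - 2 * s * h'' =
        (h' s - h' 0 - s * h'') - (h' (-s) - h' 0 - ((-s : ℝ) : ℂ) * h'') := by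
      push_cast; ring
    rw [this]
    refine (norm_sub_le _ _).trans ?_
    nlinarith [hs.2]
  have hmv := norm_image_sub_le_of_norm_deriv_le_segment'
    (fun s _ => (hder s).hasDerivWithinAt) hbd ε (right_mem_Icc.2 hε.1.le)
  have hε0 : (ε : ℂ) ≠ 0 := by exact_mod_cast hε.1.ne'
  rw [dist_eq_norm]
  have e : ((ε : ℂ) ^ 2)⁻¹ * (h ε - 2 * h 0 + h (-ε)) - h'' = ((ε : ℂ) ^ 2)⁻¹ *
      (h ε + h (-ε) - (ε : ℂ) ^ 2 * h'' - (h 0 + h (-0) - ((0 : ℝ) : ℂ) ^ 2 * h'')) := by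
    simp
    field_simp
    ring
  rw [e, norm_mul, norm_inv, norm_pow, Complex.norm_real, Real.norm_of_nonneg hε.1.le]
  have h0 : 0 < ε := hε.1
  rw [inv_mul_lt_iff₀ (by positivity)]
  refine hmv.trans_lt ?_
  nlinarith [mul_pos (mul_pos h0 h0) hη]

theorem le_of_le_add_mul_sqrt {m a D : ℝ} (hm : 0 ≤ m) (h : m ≤ a + D * √m) :
    m ≤ 2 * a + D ^ 2 := by
  nlinarith [sq_nonneg (D - √m), Real.sq_sqrt hm]

/-- Functions on `[0,∞) × ℝ` that decay rapidly in `x`, uniformly on compact time intervals. -/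
def RapidDecay (h : ℝ → ℝ → ℂ) : Prop :=
  ContinuousOn (fun p : ℝ × ℝ => h p.1 p.2) (Ici 0 ×ˢ univ) ∧
    ∀ (n : ℕ) (T : ℝ), ∃ C, ∀ t ∈ Icc 0 T, ∀ x, ‖h t x‖ * (1 + |x|) ^ n ≤ C

namespace RapidDecay

variable {f g : ℝ → ℝ → ℂ}

theorem add (hf : RapidDecay f) (hg : RapidDecay g) : RapidDecay fun t x => f t x + g t x := by
  refine ⟨hf.1.add hg.1, fun n T => ?_⟩
  obtain ⟨C, hC⟩ := hf.2 n T
  obtain ⟨D, hD⟩ := hg.2 n T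
  refine ⟨C + D, fun t ht x => ?_⟩
  have h : ‖f t x + g t x‖ * (1 + |x|) ^ n ≤ (‖f t x‖ + ‖g t x‖) * (1 + |x|) ^ n := by
    gcongr; exact norm_add_le _ _
  linarith [hC t ht x, hD t ht x]

theorem mul_of_growth (hf : RapidDecay f) {m : ℝ → ℝ → ℂ}
    (hm : Continuous fun p : ℝ × ℝ => m p.1 p.2) (k : ℕ)
    (hk : ∀ T, ∃ A, ∀ t ∈ Icc 0 T, ∀ x, ‖m t x‖ ≤ A * (1 + |x|) ^ k) :
    RapidDecay fun t x => m t x * f t x := by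
  refine ⟨hm.continuousOn.mul hf.1, fun n T => ?_⟩
  obtain ⟨C, hC⟩ := hf.2 (k + n) T
  obtain ⟨A, hA⟩ := hk T
  refine ⟨|A| * C, fun t ht x => ?_⟩
  have h1 : ‖m t x‖ ≤ |A| * (1 + |x|) ^ k := (hA t ht x).trans (by gcongr; exact le_abs_self A)
  rw [norm_mul]
  calc ‖m t x‖ * ‖f t x‖ * (1 + |x|) ^ n
      ≤ |A| * (1 + |x|) ^ k * ‖f t x‖ * (1 + |x|) ^ n := by gcongr
    _ = |A| * (‖f t x‖ * (1 + |x|) ^ (k + n)) := by rw [pow_add]; ring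
    _ ≤ |A| * C := by gcongr; exact hC t ht x

theorem const_mul (hf : RapidDecay f) (c : ℂ) : RapidDecay fun t x => c * f t x :=
  hf.mul_of_growth (m := fun _ _ => c) continuous_const 0 fun _ => ⟨‖c‖, fun t _ x => by simp⟩

theorem time_mul (hf : RapidDecay f) : RapidDecay fun t x => (t : ℂ) * f t x :=
  hf.mul_of_growth (m := fun t _ => (t : ℂ)) (by fun_prop) 0 fun T => ⟨T, fun t ht x => by
    simpa [abs_of_nonneg ht.1] using ht.2⟩

theorem space_mul (hf : RapidDecay f) : RapidDecay fun t x => (x : ℂ) * f t x :=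
  hf.mul_of_growth (m := fun _ x => (x : ℂ)) (by fun_prop) 1 fun T => ⟨1, fun t _ x => by simp⟩

theorem sub (hf : RapidDecay f) (hg : RapidDecay g) : RapidDecay fun t x => f t x - g t x := by
  simpa [sub_eq_add_neg] using hf.add (hg.const_mul (-1))

theorem boost (hf : RapidDecay f) (ε ω v : ℝ) :
    RapidDecay fun t x => Complex.exp (Complex.I * (ε * x + ω * t)) * f t (x + v * t) := by
  refine mul_of_growth (f := fun t x => f t (x + v * t))
    (m := fun t x => Complex.exp (Complex.I * (ε * x + ω * t))) ⟨?_, fun n T => ?_⟩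
    (by fun_prop) 0 fun T => ⟨1, fun t _ x => ?_⟩
  · exact hf.1.comp (f := fun p : ℝ × ℝ => (p.1, p.2 + v * p.1)) (by fun_prop)
      fun p hp => ⟨hp.1, mem_univ _⟩
  · obtain ⟨C, hC⟩ := hf.2 n T
    refine ⟨C * (1 + |v| * T) ^ n, fun t ht x => ?_⟩
    have h1 : 1 + |x| ≤ (1 + |x + v * t|) * (1 + |v| * T) := by
      have h2 : |x| ≤ |x + v * t| + |v| * T := by
        calc |x| = |(x + v * t) - v * t| := by ring_nf
          _ ≤ |x + v * t| + |v * t| := abs_sub _ _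
          _ ≤ _ := by
            rw [abs_mul, abs_of_nonneg ht.1]
            gcongr; exact ht.2
      nlinarith [abs_nonneg (x + v * t), mul_nonneg (abs_nonneg v) (ht.1.trans ht.2)]
    calc ‖f t (x + v * t)‖ * (1 + |x|) ^ n
        ≤ ‖f t (x + v * t)‖ * ((1 + |x + v * t|) * (1 + |v| * T)) ^ n := by gcongr
      _ = ‖f t (x + v * t)‖ * (1 + |x + v * t|) ^ n * (1 + |v| * T) ^ n := by
        rw [mul_pow, mul_assoc]
      _ ≤ _ := by
        have : 0 ≤ 1 + |v| * T := by
          have := mul_nonneg (abs_nonneg v) (ht.1.trans ht.2)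
          linarith
        gcongr
        exact hC t ht _
  · have : Complex.I * (ε * x + ω * t) = ((ε * x + ω * t : ℝ) : ℂ) * Complex.I := by
      push_cast; ring
    rw [this, Complex.norm_exp_ofReal_mul_I]; simp

theorem exists_bound (hf : RapidDecay f) (T : ℝ) :
    ∃ C, 0 ≤ C ∧ ∀ t ∈ Icc 0 T, ∀ x, ‖f t x‖ ≤ C * (1 + x ^ 2)⁻¹ := by
  obtain ⟨C, hC⟩ := hf.2 2 T
  refine ⟨|C|, abs_nonneg C, fun t ht x => ?_⟩
  rw [← div_eq_mul_inv, le_div_iff₀ (by positivity)]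
  refine le_trans (mul_le_mul_of_nonneg_left ?_ (norm_nonneg _))
    ((hC t ht x).trans (le_abs_self C))
  nlinarith [abs_nonneg x, sq_abs x]

theorem norm_mul_bound (hf : RapidDecay f) (hg : RapidDecay g) (T : ℝ) :
    ∃ C, 0 ≤ C ∧ ∀ t ∈ Icc 0 T, ∀ x, ‖f t x‖ * ‖g t x‖ ≤ C * (1 + x ^ 2)⁻¹ := by
  obtain ⟨C, hC0, hC⟩ := hf.exists_bound T
  obtain ⟨D, hD0, hD⟩ := hg.exists_bound T
  refine ⟨C * D, by positivity, fun t ht x => ?_⟩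
  have h1 : (1 + x ^ 2)⁻¹ ≤ 1 := inv_le_one_of_one_le₀ (by nlinarith)
  have h2 : ‖g t x‖ ≤ D := (hD t ht x).trans (mul_le_of_le_one_right hD0 h1)
  calc ‖f t x‖ * ‖g t x‖ ≤ C * (1 + x ^ 2)⁻¹ * D :=
        mul_le_mul (hC t ht x) h2 (norm_nonneg _) (by positivity)
    _ = _ := by ring

theorem continuous_slice (hf : RapidDecay f) {t : ℝ} (ht : 0 ≤ t) : Continuous (f t) :=
  hf.1.comp_continuous (f := fun x : ℝ => (t, x)) (by fun_prop) fun x => ⟨ht, mem_univ _⟩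

theorem continuousOn_time (hf : RapidDecay f) (x : ℝ) : ContinuousOn (fun t => f t x) (Ici 0) :=
  hf.1.comp (f := fun t : ℝ => (t, x)) (by fun_prop) fun t ht => ⟨ht, mem_univ _⟩

theorem slice (hf : RapidDecay f) {t : ℝ} (ht : 0 ≤ t) : QuadDecay (f t) := by
  obtain ⟨C, -, hC⟩ := hf.exists_bound t
  exact ⟨hf.continuous_slice ht, C, hC t ⟨ht, le_rfl⟩⟩

theorem norm_sq_bound (hf : RapidDecay f) (T : ℝ) :
    ∃ C, 0 ≤ C ∧ ∀ t ∈ Icc 0 T, ∀ x, ‖f t x‖ ^ 2 ≤ C * (1 + x ^ 2)⁻¹ := by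
  simpa only [sq] using hf.norm_mul_bound hf T

theorem exists_integral_norm_sq_le (hf : RapidDecay f) (T : ℝ) :
    ∃ B, ∀ t ∈ Icc 0 T, ∫ x, ‖f t x‖ ^ 2 ≤ B := by
  obtain ⟨C, -, hC⟩ := hf.norm_sq_bound T
  exact ⟨∫ x, C * (1 + x ^ 2)⁻¹, fun t ht => integral_mono
    (hf.slice ht.1).integrable_norm_sq (integrable_inv_one_add_sq.const_mul C) (hC t ht)⟩

theorem continuousOn_integral_norm_sq (hf : RapidDecay f) (T : ℝ) :
    ContinuousOn (fun t => ∫ x, ‖f t x‖ ^ 2) (Icc 0 T) := by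
  obtain ⟨C, -, hC⟩ := hf.norm_sq_bound T
  refine continuousOn_of_dominated (bound := fun x => C * (1 + x ^ 2)⁻¹)
    (fun t ht => ((hf.continuous_slice ht.1).norm.pow 2).aestronglyMeasurable)
    (fun t ht => ae_of_all _ fun x => ?_) (integrable_inv_one_add_sq.const_mul C)
    (ae_of_all _ fun x => ((hf.continuousOn_time x).mono Icc_subset_Ici_self).norm.pow 2)
  rw [Real.norm_of_nonneg (by positivity)]
  exact hC t ht x

end RapidDecay

/-- `f` has the rapidly decaying partial derivatives `ft`, `fx`, `fxx`. -/
structure RapidC12 (f ft fx fxx : ℝ → ℝ → ℂ) : Prop where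
  deriv_t : ∀ t, 0 < t → ∀ x, HasDerivAt (fun s => f s x) (ft t x) t
  deriv_x : ∀ t, 0 ≤ t → ∀ x, HasDerivAt (f t) (fx t x) x
  deriv_xx : ∀ t, 0 ≤ t → ∀ x, HasDerivAt (fx t) (fxx t x) x
  decay : RapidDecay f
  decay_t : RapidDecay ft
  decay_x : RapidDecay fx
  decay_xx : RapidDecay fxx

namespace RapidC12

variable {f ft fx fxx g gt gx gxx : ℝ → ℝ → ℂ}

theorem rapidDecay_of_le {c₂ c₁ c₀ α : ℝ} {lam : ℂ} {u v : ℝ → ℝ → ℂ}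
    (S : SchwartzSolution c₂ c₁ c₀ α lam u)
    (hv : ContinuousOn (fun p : ℝ × ℝ => v p.1 p.2) (Ici 0 ×ˢ univ))
    (hle : ∀ t x, ‖v t x‖ ≤ ‖u t x‖ + ‖S.ut t x‖ + ‖S.ux t x‖ + ‖S.uxx t x‖) :
    RapidDecay v := by
  refine ⟨hv, fun n T => ?_⟩
  obtain ⟨C, hC⟩ := S.hdecay n (|T| + 1) (by positivity)
  refine ⟨C, fun t ht x => le_trans ?_ (hC t ⟨ht.1, ht.2.trans (by linarith [le_abs_self T])⟩ x)⟩
  gcongr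
  exact hle t x

theorem of_schwartzSolution {c₂ c₁ c₀ α : ℝ} {lam : ℂ} {u : ℝ → ℝ → ℂ}
    (S : SchwartzSolution c₂ c₁ c₀ α lam u) : RapidC12 u S.ut S.ux S.uxx where
  deriv_t t ht x := (S.hut x t ht.le).hasDerivAt (Ici_mem_nhds ht)
  deriv_x t ht x := S.hux t ht x
  deriv_xx t ht x := S.huxx t ht x
  decay := rapidDecay_of_le S S.hu_cont fun t x => by
    linarith [norm_nonneg (S.ut t x), norm_nonneg (S.ux t x), norm_nonneg (S.uxx t x)]
  decay_t := rapidDecay_of_le S S.hut_cont fun t x => by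
    linarith [norm_nonneg (u t x), norm_nonneg (S.ux t x), norm_nonneg (S.uxx t x)]
  decay_x := rapidDecay_of_le S S.hux_cont fun t x => by
    linarith [norm_nonneg (u t x), norm_nonneg (S.ut t x), norm_nonneg (S.uxx t x)]
  decay_xx := rapidDecay_of_le S S.huxx_cont fun t x => by
    linarith [norm_nonneg (u t x), norm_nonneg (S.ut t x), norm_nonneg (S.ux t x)]

theorem add_const_mul (hf : RapidC12 f ft fx fxx) (hg : RapidC12 g gt gx gxx) (c : ℂ) :
    RapidC12 (fun t x => f t x + c * g t x) (fun t x => ft t x + c * gt t x)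
      (fun t x => fx t x + c * gx t x) (fun t x => fxx t x + c * gxx t x) where
  deriv_t t ht x := (hf.deriv_t t ht x).fun_add ((hg.deriv_t t ht x).const_mul c)
  deriv_x t ht x := (hf.deriv_x t ht x).fun_add ((hg.deriv_x t ht x).const_mul c)
  deriv_xx t ht x := (hf.deriv_xx t ht x).fun_add ((hg.deriv_xx t ht x).const_mul c)
  decay := hf.decay.add (hg.decay.const_mul c)
  decay_t := hf.decay_t.add (hg.decay_t.const_mul c)
  decay_x := hf.decay_x.add (hg.decay_x.const_mul c)
  decay_xx := hf.decay_xx.add (hg.decay_xx.const_mul c)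

theorem hasDerivAt_moving (hf : RapidC12 f ft fx fxx) (v : ℝ) {t : ℝ} (ht : 0 < t) (x : ℝ) :
    HasDerivAt (fun s => f s (x + v * s)) (ft t (x + v * t) + v * fx t (x + v * t)) t := by
  have hnhds : ∀ᶠ p : ℝ × ℝ in 𝓝 (t, x + v * t), 0 < p.1 :=
    continuous_fst.continuousAt.eventually (lt_mem_nhds ht)
  have hmem : (Ici (0 : ℝ) ×ˢ (univ : Set ℝ)) ∈ 𝓝 (t, x + v * t) :=
    prod_mem_nhds (Ici_mem_nhds ht) univ_mem
  have hcont : ∀ {h : ℝ → ℝ → ℂ}, RapidDecay h → ContinuousAt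
      (fun p : ℝ × ℝ => ContinuousLinearMap.toSpanSingleton ℝ (h p.1 p.2)) (t, x + v * t) := by
    intro h hh
    exact (ContinuousLinearMap.toSpanSingletonCLE (𝕜 := ℝ) (E := ℂ)).continuous.continuousAt.comp
      (hh.1.continuousAt hmem)
  have hF := (hasStrictFDerivAt_uncurry_coprod (𝕜 := ℝ) (u := (t, x + v * t)) (f := f)
    (f₁ := fun t x => ContinuousLinearMap.toSpanSingleton ℝ (ft t x))
    (f₂ := fun t x => ContinuousLinearMap.toSpanSingleton ℝ (fx t x))
    (hnhds.mono fun p hp => (hf.deriv_t p.1 hp p.2).hasFDerivAt)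
    (hnhds.mono fun p hp => (hf.deriv_x p.1 hp.le p.2).hasFDerivAt)
    (hcont hf.decay_t) (hcont hf.decay_x)).hasFDerivAt
  have hp : HasDerivAt (fun s : ℝ => (s, x + v * s)) (1, v) t :=
    (hasDerivAt_id t).prodMk (by simpa using ((hasDerivAt_id t).const_mul v).const_add x)
  have := hF.comp_hasDerivAt t hp
  simpa [Function.HasUncurry.uncurry, Function.comp_def] using this

theorem boost (hf : RapidC12 f ft fx fxx) (ε ω v : ℝ) :
    RapidC12 (fun t x => Complex.exp (Complex.I * (ε * x + ω * t)) * f t (x + v * t))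
      (fun t x => Complex.exp (Complex.I * (ε * x + ω * t)) *
        (Complex.I * ω * f t (x + v * t) + ft t (x + v * t) + v * fx t (x + v * t)))
      (fun t x => Complex.exp (Complex.I * (ε * x + ω * t)) *
        (Complex.I * ε * f t (x + v * t) + fx t (x + v * t)))
      (fun t x => Complex.exp (Complex.I * (ε * x + ω * t)) *
        (-ε ^ 2 * f t (x + v * t) + 2 * Complex.I * ε * fx t (x + v * t)
          + fxx t (x + v * t))) := by
  have hex : ∀ t x : ℝ, HasDerivAt (fun y : ℝ => Complex.exp (Complex.I * (ε * y + ω * t)))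
      (Complex.exp (Complex.I * (ε * x + ω * t)) * (Complex.I * ε)) x := by
    intro t x
    have := (((Complex.ofRealCLM.hasDerivAt (x := x)).const_mul (ε : ℂ)).add_const
      ((ω : ℂ) * t)).const_mul Complex.I
    simpa using this.cexp
  have het : ∀ t x : ℝ, HasDerivAt (fun s : ℝ => Complex.exp (Complex.I * (ε * x + ω * s)))
      (Complex.exp (Complex.I * (ε * x + ω * t)) * (Complex.I * ω)) t := by
    intro t x
    have := (((Complex.ofRealCLM.hasDerivAt (x := t)).const_mul (ω : ℂ)).const_add
      ((ε : ℂ) * x)).const_mul Complex.I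
    simpa using this.cexp
  refine ⟨fun t ht x => ?_, fun t ht x => ?_, fun t ht x => ?_, hf.decay.boost ε ω v, ?_, ?_, ?_⟩
  · exact ((het t x).fun_mul (hf.hasDerivAt_moving v ht x)).congr_deriv (by ring)
  · exact ((hex t x).fun_mul ((hf.deriv_x t ht (x + v * t)).comp_add_const x (v * t))).congr_deriv
      (by ring)
  · have h1 := (hf.deriv_x t ht (x + v * t)).comp_add_const x (v * t)
    have h2 := (hf.deriv_xx t ht (x + v * t)).comp_add_const x (v * t)
    refine ((hex t x).fun_mul ((h1.const_mul (Complex.I * ε)).fun_add h2)).congr_deriv ?_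
    linear_combination (Complex.exp (Complex.I * (ε * x + ω * t)) * ε ^ 2 * f t (x + v * t)) *
      Complex.I_sq
  · exact (((hf.decay.const_mul (Complex.I * ω)).add hf.decay_t).add
      (hf.decay_x.const_mul v)).boost ε ω v
  · exact ((hf.decay.const_mul (Complex.I * ε)).add hf.decay_x).boost ε ω v
  · exact (((hf.decay.const_mul (-(ε : ℂ) ^ 2)).add
      (hf.decay_x.const_mul (2 * Complex.I * ε))).add hf.decay_xx).boost ε ω v

theorem hasDerivAt_integral_norm_sq (hf : RapidC12 f ft fx fxx) {t : ℝ} (ht : 0 < t) :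
    HasDerivAt (fun t => ∫ x, ‖f t x‖ ^ 2) (∫ x, 2 * inner ℝ (f t x) (ft t x)) t := by
  obtain ⟨C, -, hC⟩ := hf.decay.norm_mul_bound hf.decay_t (t + 1)
  have hs : Ioo 0 (t + 1) ∈ 𝓝 t := Ioo_mem_nhds ht (by linarith)
  refine (hasDerivAt_integral_of_dominated_loc_of_deriv_le (F := fun t x => ‖f t x‖ ^ 2)
    (F' := fun t x => 2 * inner ℝ (f t x) (ft t x))
    (bound := fun x => 2 * (C * (1 + x ^ 2)⁻¹)) hs ?_ (hf.decay.slice ht.le).integrable_norm_sq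
    ?_ (ae_of_all _ fun x s hs => ?_) ((integrable_inv_one_add_sq.const_mul C).const_mul 2)
    (ae_of_all _ fun x s hs => (hf.deriv_t s hs.1 x).norm_sq)).2
  · filter_upwards [hs] with s hs
    exact ((hf.decay.continuous_slice hs.1.le).norm.pow 2).aestronglyMeasurable
  · exact (continuous_const.mul ((hf.decay.continuous_slice ht.le).inner
      (hf.decay_t.continuous_slice ht.le))).aestronglyMeasurable
  · rw [norm_mul, Real.norm_ofNat]
    gcongr
    exact (norm_inner_le_norm _ _).trans (hC s ⟨hs.1.le, hs.2.le⟩ x)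

theorem integral_inner_dispersion_eq_zero (hf : RapidC12 f ft fx fxx) (c₂ c₁ c₀ : ℝ) {t : ℝ}
    (ht : 0 ≤ t) :
    ∫ x, 2 * inner ℝ (f t x)
      (-Complex.I * c₂ * fxx t x + c₁ * fx t x + Complex.I * c₀ * f t x) = 0 := by
  have hq := hf.decay.slice ht
  have hqx := hf.decay_x.slice ht
  have hqxx := hf.decay_xx.slice ht
  have hint := (hq.integrable_inner (((hqxx.const_mul (-Complex.I * c₂)).add
    (hqx.const_mul c₁)).add (hq.const_mul (Complex.I * c₀)))).const_mul 2
  have hd : ∀ x, HasDerivAt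
      (fun y => 2 * inner ℝ (f t y) (-Complex.I * c₂ * fx t y) + c₁ * ‖f t y‖ ^ 2)
      (2 * inner ℝ (f t x)
        (-Complex.I * c₂ * fxx t x + c₁ * fx t x + Complex.I * c₀ * f t x)) x := by
    intro x
    have h1 := ((hf.deriv_x t ht x).inner ℝ
      ((hf.deriv_xx t ht x).const_mul (-Complex.I * c₂))).const_mul 2
    have h2 := (hf.deriv_x t ht x).norm_sq.const_mul c₁
    refine (h1.fun_add h2).congr_deriv ?_
    simp only [Complex.inner, Complex.mul_re, Complex.mul_im, Complex.add_re, Complex.add_im,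
      Complex.neg_re, Complex.neg_im, Complex.I_re, Complex.I_im, Complex.ofReal_re,
      Complex.ofReal_im, Complex.conj_re, Complex.conj_im]
    ring
  have hlim : ∀ l : Filter ℝ, Tendsto (f t) l (𝓝 0) → Tendsto (fx t) l (𝓝 0) → Tendsto
      (fun y => 2 * inner ℝ (f t y) (-Complex.I * c₂ * fx t y) + c₁ * ‖f t y‖ ^ 2) l (𝓝 0) := by
    intro l h1 h2
    simpa using ((h1.inner (h2.const_mul (-Complex.I * c₂))).const_mul 2).add
      ((h1.norm.pow 2).const_mul c₁)
  rw [integral_of_hasDerivAt_of_tendsto hd hint (hlim _ hq.tendsto_atBot hqx.tendsto_atBot)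
    (hlim _ hq.tendsto_atTop hqx.tendsto_atTop), sub_zero]

theorem hasDerivAt_energy (hf : RapidC12 f ft fx fxx) {c₂ c₁ c₀ : ℝ} {F : ℝ → ℂ} {t : ℝ}
    (ht : 0 < t)
    (hF : ∀ x, ft t x = -Complex.I * c₂ * fxx t x + c₁ * fx t x + Complex.I * c₀ * f t x + F x) :
    QuadDecay F ∧
      HasDerivAt (fun t => ∫ x, ‖f t x‖ ^ 2) (∫ x, 2 * inner ℝ (f t x) (F x)) t := by
  have hq := hf.decay.slice ht.le
  have hlin := (((hf.decay_xx.slice ht.le).const_mul (-Complex.I * c₂)).add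
    ((hf.decay_x.slice ht.le).const_mul c₁)).add (hq.const_mul (Complex.I * c₀))
  have hQF : QuadDecay F := by
    have := (hf.decay_t.slice ht.le).add (hlin.const_mul (-1))
    convert this using 2 with x
    rw [hF x]; ring
  refine ⟨hQF, (hf.hasDerivAt_integral_norm_sq ht).congr_deriv ?_⟩
  simp only [hF, inner_add_right _ _ (F _), mul_add]
  rw [integral_add _ ((hq.integrable_inner hQF).const_mul 2)]
  · have := hf.integral_inner_dispersion_eq_zero c₂ c₁ c₀ ht.le
    rw [this, zero_add]
  · exact (hq.integrable_inner hlin).const_mul 2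

end RapidC12

theorem powNL_unit_mul (α : ℝ) {e : ℂ} (he : ‖e‖ = 1) (z : ℂ) :
    powNL α (e * z) = e * powNL α z := by
  simp only [powNL, norm_mul, he, one_mul]; ring

theorem powNLDeriv_add (α : ℝ) (z v w : ℂ) :
    powNLDeriv α z (v + w) = powNLDeriv α z v + powNLDeriv α z w := by
  simp only [powNLDeriv, map_add, mul_add, Complex.add_re]
  push_cast; ring

/-- Rapidly decaying solutions of `∂_t f = -i c₂ ∂_x² f + c₁ ∂_x f + i c₀ f + i λ |f|^α f`. -/
def IsRapidSolution (c₂ c₁ c₀ α : ℝ) (lam : ℂ) (f : ℝ → ℝ → ℂ) : Prop :=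
  ∃ ft fx fxx, RapidC12 f ft fx fxx ∧ ∀ t, 0 < t → ∀ x, ft t x =
    -Complex.I * c₂ * fxx t x + c₁ * fx t x + Complex.I * c₀ * f t x
      + Complex.I * lam * powNL α (f t x)

/-- The Galilean group `exp (i ε 𝓛)`. -/
def galilean (c₂ c₁ ε : ℝ) (f : ℝ → ℝ → ℂ) : ℝ → ℝ → ℂ := fun t x =>
  Complex.exp (Complex.I * (ε * x + ((ε * c₁ + c₂ * ε ^ 2 : ℝ) : ℂ) * t)) *
    f t (x + 2 * c₂ * ε * t)

theorem norm_exp_I_mul_phase (ε x ω t : ℝ) :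
    ‖Complex.exp (Complex.I * (ε * x + ω * t))‖ = 1 := by
  have : Complex.I * (ε * x + ω * t) = ((ε * x + ω * t : ℝ) : ℂ) * Complex.I := by
    push_cast; ring
  rw [this, Complex.norm_exp_ofReal_mul_I]

theorem norm_galilean (c₂ c₁ ε : ℝ) (f : ℝ → ℝ → ℂ) (t x : ℝ) :
    ‖galilean c₂ c₁ ε f t x‖ = ‖f t (x + 2 * c₂ * ε * t)‖ := by
  rw [galilean, norm_mul, norm_exp_I_mul_phase, one_mul]

theorem galilean_zero (c₂ c₁ : ℝ) (f : ℝ → ℝ → ℂ) : galilean c₂ c₁ 0 f = f := by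
  ext t x; simp [galilean]

/-- The vector field `𝓛` applied to a function with prescribed spatial derivative. -/
def vectorField (c₂ c₁ : ℝ) (f f' : ℝ → ℝ → ℂ) : ℝ → ℝ → ℂ := fun t x =>
  (x + c₁ * t) * f t x - 2 * Complex.I * c₂ * t * f' t x

theorem hasDerivAt_galilean {c₂ c₁ : ℝ} {f f' : ℝ → ℝ → ℂ} {t : ℝ}
    (hf : ∀ x, HasDerivAt (f t) (f' t x) x) (s x : ℝ) :
    HasDerivAt (fun r => galilean c₂ c₁ r f t x)
      (Complex.I * galilean c₂ c₁ s (vectorField c₂ c₁ f f') t x) s := by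
  have h0 := Complex.ofRealCLM.hasDerivAt (x := s)
  have h1 : HasDerivAt (fun r : ℝ => (r : ℂ) * x + ((r * c₁ + c₂ * r ^ 2 : ℝ) : ℂ) * t)
      (x + (c₁ + 2 * c₂ * s) * t) s := by
    have ha : HasDerivAt (fun r : ℝ => r * c₁ + c₂ * r ^ 2) (c₁ + 2 * c₂ * s) s := by
      refine (((hasDerivAt_id s).mul_const c₁).fun_add
        (((hasDerivAt_id s).fun_pow 2).const_mul c₂)).congr_deriv ?_
      simp; ring
    have hb := (h0.mul_const (x : ℂ)).fun_add (ha.ofReal_comp.mul_const (t : ℂ))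
    simpa using hb
  have h2 := (h1.const_mul Complex.I).cexp
  have h3 : HasDerivAt (fun r : ℝ => x + 2 * c₂ * r * t) (2 * c₂ * t) s := by
    refine ((((hasDerivAt_id s).const_mul (2 * c₂)).mul_const t).const_add x).congr_deriv ?_
    simp
  have h4 := (hf (x + 2 * c₂ * s * t)).scomp s h3
  refine (h2.fun_mul h4).congr_deriv ?_
  simp only [galilean, vectorField, Function.comp_def, Complex.real_smul]
  push_cast
  linear_combination (2 * c₂ * t * Complex.exp (Complex.I * (s * x +
    (s * c₁ + c₂ * s ^ 2) * t)) * f' t (x + 2 * c₂ * s * t)) * Complex.I_sq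

namespace IsRapidSolution

variable {c₂ c₁ c₀ α : ℝ} {lam : ℂ} {a b c u : ℝ → ℝ → ℂ}

theorem rapidDecay (hu : IsRapidSolution c₂ c₁ c₀ α lam u) : RapidDecay u := by
  obtain ⟨_, _, _, h, -⟩ := hu
  exact h.decay

theorem of_schwartzSolution (S : SchwartzSolution c₂ c₁ c₀ α lam u) :
    IsRapidSolution c₂ c₁ c₀ α lam u := by
  refine ⟨S.ut, S.ux, S.uxx, RapidC12.of_schwartzSolution S, fun t ht x => ?_⟩
  have h := S.heq t ht x
  rw [powNL]
  linear_combination Complex.I * h + S.ut t x * Complex.I_sq - c₁ * S.ux t x * Complex.I_sq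

theorem zero : IsRapidSolution c₂ c₁ c₀ α lam fun _ _ => 0 := by
  have h : RapidDecay fun _ _ => 0 := ⟨continuousOn_const, fun n T => ⟨0, by simp⟩⟩
  exact ⟨fun _ _ => 0, fun _ _ => 0, fun _ _ => 0,
    ⟨fun t _ x => hasDerivAt_const t 0, fun t _ x => hasDerivAt_const x 0,
      fun t _ x => hasDerivAt_const x 0, h, h, h, h⟩, by simp [powNL]⟩

theorem galilean (hu : IsRapidSolution c₂ c₁ c₀ α lam u) (ε : ℝ) :
    IsRapidSolution c₂ c₁ c₀ α lam (galilean c₂ c₁ ε u) := by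
  obtain ⟨ut, ux, uxx, hR, heq⟩ := hu
  refine ⟨_, _, _, hR.boost ε (ε * c₁ + c₂ * ε ^ 2) (2 * c₂ * ε), fun t ht x => ?_⟩
  rw [_root_.galilean, powNL_unit_mul α (norm_exp_I_mul_phase ε x _ t), heq t ht]
  push_cast
  linear_combination (Complex.exp (Complex.I * (ε * x + (ε * c₁ + c₂ * ε ^ 2) * t)) *
    (2 * c₂ * ε * ux t (x + 2 * c₂ * ε * t))) * Complex.I_sq

theorem integral_norm_sub_sq_le (hα : 0 < α) (hlam : α * |lam.re| / (2 * √(α + 1)) ≤ lam.im)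
    (ha : IsRapidSolution c₂ c₁ c₀ α lam a) (hb : IsRapidSolution c₂ c₁ c₀ α lam b)
    {t : ℝ} (ht : 0 ≤ t) : ∫ x, ‖a t x - b t x‖ ^ 2 ≤ ∫ x, ‖a 0 x - b 0 x‖ ^ 2 := by
  obtain ⟨at', ax, axx, hRa, ea⟩ := ha
  obtain ⟨bt, bx, bxx, hRb, eb⟩ := hb
  have hR := hRa.add_const_mul hRb (-1)
  have hE : ∀ s, 0 < s → HasDerivAt (fun s => ∫ x, ‖a s x + -1 * b s x‖ ^ 2)
      (∫ x, 2 * inner ℝ (a s x + -1 * b s x)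
        (Complex.I * lam * (powNL α (a s x) - powNL α (b s x)))) s := fun s hs =>
    (hR.hasDerivAt_energy (c₂ := c₂) (c₁ := c₁) (c₀ := c₀) hs fun x => by rw [ea s hs x, eb s hs x]; ring).2
  have hanti := antitoneOn_of_deriv_nonpos (convex_Icc 0 t)
    (hR.decay.continuousOn_integral_norm_sq t)
    (by
      rw [interior_Icc]
      exact fun s hs => (hE s hs.1).differentiableAt.differentiableWithinAt)
    (by
      rw [interior_Icc]
      intro s hs
      rw [(hE s hs.1).deriv]
      refine integral_nonpos fun x => ?_
      have := re_powNL_sub_mul_conj_nonpos hα hlam (a s x) (b s x)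
      rw [Complex.inner, show a s x + -1 * b s x = a s x - b s x by ring]
      simp only [Pi.zero_apply]
      linarith)
  have := hanti (left_mem_Icc.2 ht) (right_mem_Icc.2 ht) ht
  simpa [← sub_eq_add_neg] using this

theorem hasDerivAt_second_difference (hα : 1 ≤ α)
    (hlam : α * |lam.re| / (2 * √(α + 1)) ≤ lam.im)
    (ha : IsRapidSolution c₂ c₁ c₀ α lam a) (hb : IsRapidSolution c₂ c₁ c₀ α lam b)
    (hc : IsRapidSolution c₂ c₁ c₀ α lam c) {t S P Q : ℝ} (ht : 0 < t)
    (hSa : ∀ x, ‖a t x‖ ≤ S) (hSb : ∀ x, ‖b t x‖ ≤ S) (hSc : ∀ x, ‖c t x‖ ≤ S)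
    (hPa : ∀ x, ‖a t x - b t x‖ ≤ P) (hPc : ∀ x, ‖c t x - b t x‖ ≤ P)
    (hQa : √(∫ x, ‖a t x - b t x‖ ^ 2) ≤ Q) (hQc : √(∫ x, ‖c t x - b t x‖ ^ 2) ≤ Q) :
    ∃ E', HasDerivAt (fun t => ∫ x, ‖a t x - 2 * b t x + c t x‖ ^ 2) E' t ∧
      E' ≤ 2 * (2 * ‖lam‖ * (α ^ 2 + 5 * α) * S ^ (α - 1) * P * Q) *
        √(∫ x, ‖a t x - 2 * b t x + c t x‖ ^ 2) := by
  have hda := ((ha.rapidDecay.sub hb.rapidDecay).slice ht.le)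
  have hdc := ((hc.rapidDecay.sub hb.rapidDecay).slice ht.le)
  obtain ⟨at', ax, axx, hRa, ea⟩ := ha
  obtain ⟨bt, bx, bxx, hRb, eb⟩ := hb
  obtain ⟨ct, cx, cxx, hRc, ec⟩ := hc
  have hR := (hRa.add_const_mul hRb (-2)).add_const_mul hRc 1
  have hrw : ∀ t x, a t x + -2 * b t x + 1 * c t x = a t x - 2 * b t x + c t x := by
    intro t x; ring
  have hRd := hR.decay.slice ht.le
  obtain ⟨hQF, hE⟩ := hR.hasDerivAt_energy (c₂ := c₂) (c₁ := c₁) (c₀ := c₀) ht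
    (F := fun x => Complex.I * lam * (powNL α (a t x) - 2 * powNL α (b t x) + powNL α (c t x)))
    (fun x => by rw [ea t ht x, eb t ht x, ec t ht x]; ring)
  simp only [hrw] at hE hRd
  refine ⟨_, hE, ?_⟩
  have hS : 0 ≤ S := (norm_nonneg _).trans (hSb 0)
  have hP : 0 ≤ P := (norm_nonneg _).trans (hPa 0)
  set k := α ^ 2 + 5 * α with hk
  have hk0 : 0 ≤ k := by positivity
  have hpt : ∀ x, 2 * inner ℝ (a t x - 2 * b t x + c t x)
      (Complex.I * lam * (powNL α (a t x) - 2 * powNL α (b t x) + powNL α (c t x))) ≤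
      2 * ‖lam‖ * k * S ^ (α - 1) * P * (‖a t x - b t x‖ * ‖a t x - 2 * b t x + c t x‖
        + ‖c t x - b t x‖ * ‖a t x - 2 * b t x + c t x‖) := by
    intro x
    set f := a t x - 2 * b t x + c t x with hf
    have hta := norm_powNL_taylor_le hα (hSa x) (hSb x)
    have htc := norm_powNL_taylor_le hα (hSc x) (hSb x)
    set Ra := powNL α (a t x) - powNL α (b t x) - powNLDeriv α (b t x) (a t x - b t x) with hRa'
    set Rc := powNL α (c t x) - powNL α (b t x) - powNLDeriv α (b t x) (c t x - b t x) with hRc'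
    have hsum : powNL α (a t x) - 2 * powNL α (b t x) + powNL α (c t x) =
        powNLDeriv α (b t x) f + (Ra + Rc) := by
      rw [show f = (a t x - b t x) + (c t x - b t x) by rw [hf]; ring, powNLDeriv_add, hRa', hRc']
      ring
    have hdis := re_powNLDeriv_mul_conj_nonpos (by linarith : 0 < α) hlam (b t x) f
    have hRbd : ‖Ra + Rc‖ ≤ k * S ^ (α - 1) * P * (‖a t x - b t x‖ + ‖c t x - b t x‖) := by
      have hn : ∀ r, 0 ≤ r → r ≤ P → k * S ^ (α - 1) * r ^ 2 ≤ k * S ^ (α - 1) * P * r := by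
        intro r h0 h1
        rw [sq, ← mul_assoc]
        gcongr
      have := norm_add_le Ra Rc
      have h1 := hn _ (norm_nonneg _) (hPa x)
      have h2 := hn _ (norm_nonneg _) (hPc x)
      linarith
    rw [hsum, mul_add, inner_add_right]
    have h1 : inner ℝ f (Complex.I * lam * powNLDeriv α (b t x) f) ≤ 0 := by
      rw [Complex.inner]; exact hdis
    have h2 : inner ℝ f (Complex.I * lam * (Ra + Rc)) ≤ ‖f‖ * (‖lam‖ * ‖Ra + Rc‖) := by
      refine (real_inner_le_norm _ _).trans (by simp)
    have h3 : ‖f‖ * (‖lam‖ * ‖Ra + Rc‖) ≤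
        ‖f‖ * (‖lam‖ * (k * S ^ (α - 1) * P * (‖a t x - b t x‖ + ‖c t x - b t x‖))) := by
      gcongr
    nlinarith
  have hia := hda.integrable_norm_mul hRd
  have hic := hdc.integrable_norm_mul hRd
  have hRint := hR.decay.slice ht.le
  simp only [hrw] at hRint
  refine (integral_mono ((hRint.integrable_inner hQF).const_mul 2)
    ((hia.add hic).const_mul _) hpt).trans ?_
  rw [integral_const_mul]
  have hsum : ∫ x, (‖a t x - b t x‖ * ‖a t x - 2 * b t x + c t x‖
      + ‖c t x - b t x‖ * ‖a t x - 2 * b t x + c t x‖) ≤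
      2 * Q * √(∫ x, ‖a t x - 2 * b t x + c t x‖ ^ 2) := by
    rw [integral_add hia hic]
    have h1 := (hda.integral_norm_mul_le hRd).trans
      (mul_le_mul_of_nonneg_right hQa (Real.sqrt_nonneg _))
    have h2 := (hdc.integral_norm_mul_le hRd).trans
      (mul_le_mul_of_nonneg_right hQc (Real.sqrt_nonneg _))
    linarith
  calc _ ≤ 2 * ‖lam‖ * k * S ^ (α - 1) * P *
        (2 * Q * √(∫ x, ‖a t x - 2 * b t x + c t x‖ ^ 2)) := by
          gcongr; exact hsum
    _ = _ := by ring

end IsRapidSolution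

theorem RapidDecay.vectorField {f f' : ℝ → ℝ → ℂ} (hf : RapidDecay f) (hf' : RapidDecay f')
    (c₂ c₁ : ℝ) : RapidDecay (vectorField c₂ c₁ f f') := by
  have h := (hf.space_mul.add (hf.time_mul.const_mul c₁)).sub
    (hf'.time_mul.const_mul (2 * Complex.I * c₂))
  convert h using 3
  simp only [_root_.vectorField]
  ring

theorem hasDerivAt_vectorField {c₂ c₁ t x : ℝ} {f f' f'' : ℝ → ℝ → ℂ}
    (hf : HasDerivAt (f t) (f' t x) x) (hf' : HasDerivAt (f' t) (f'' t x) x) :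
    HasDerivAt (vectorField c₂ c₁ f f' t) (f t x + vectorField c₂ c₁ f' f'' t x) x := by
  have h0 : HasDerivAt (fun y : ℝ => (y : ℂ) + c₁ * t) 1 x := by
    simpa using (Complex.ofRealCLM.hasDerivAt (x := x)).add_const ((c₁ : ℂ) * t)
  refine ((h0.fun_mul hf).fun_sub (hf'.const_mul (2 * Complex.I * c₂ * t))).congr_deriv ?_
  simp only [vectorField]
  ring

theorem norm_galilean_sub_le {c₂ c₁ t M : ℝ} {f f' : ℝ → ℝ → ℂ}
    (hf : ∀ x, HasDerivAt (f t) (f' t x) x) (hM : ∀ x, ‖vectorField c₂ c₁ f f' t x‖ ≤ M)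
    (ε x : ℝ) : ‖galilean c₂ c₁ ε f t x - f t x‖ ≤ M * |ε| := by
  have h := convex_univ.norm_image_sub_le_of_norm_hasDerivWithin_le (C := M)
    (fun s _ => (hasDerivAt_galilean (c₂ := c₂) (c₁ := c₁) hf s x).hasDerivWithinAt)
    (fun s _ => by simpa [norm_galilean] using hM _) (mem_univ 0) (mem_univ ε)
  simpa [galilean_zero] using h

theorem galilean_initial (c₂ c₁ ε : ℝ) (f : ℝ → ℝ → ℂ) (x : ℝ) :
    galilean c₂ c₁ ε f 0 x = Complex.exp (Complex.I * (ε * x : ℝ)) * f 0 x := by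
  simp [galilean]

theorem norm_exp_second_difference_le (θ : ℝ) :
    ‖Complex.exp (Complex.I * θ) - 2 + Complex.exp (-(Complex.I * θ))‖ ≤ θ ^ 2 := by
  have h1 : Complex.exp (Complex.I * θ) * Complex.exp (-(Complex.I * θ)) = 1 := by
    rw [← Complex.exp_add]; simp
  have h2 : Complex.exp (Complex.I * θ) - 2 + Complex.exp (-(Complex.I * θ)) =
      -((Complex.exp (Complex.I * θ) - 1) * (Complex.exp (Complex.I * (-θ : ℝ)) - 1)) := by
    push_cast
    rw [mul_neg]
    linear_combination h1
  rw [h2, norm_neg, norm_mul]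
  calc _ ≤ ‖θ‖ * ‖-θ‖ := mul_le_mul (Real.norm_exp_I_mul_ofReal_sub_one_le (x := θ))
        (Real.norm_exp_I_mul_ofReal_sub_one_le (x := -θ)) (norm_nonneg _) (norm_nonneg _)
    _ = θ ^ 2 := by rw [norm_neg, Real.norm_eq_abs, ← sq, sq_abs]

namespace IsRapidSolution

variable {c₂ c₁ c₀ α : ℝ} {lam : ℂ} {u ut ux uxx : ℝ → ℝ → ℂ}

theorem integral_norm_sq_le (hα : 0 < α) (hlam : α * |lam.re| / (2 * √(α + 1)) ≤ lam.im)
    (hu : IsRapidSolution c₂ c₁ c₀ α lam u) {t : ℝ} (ht : 0 ≤ t) :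
    ∫ x, ‖u t x‖ ^ 2 ≤ ∫ x, ‖u 0 x‖ ^ 2 := by
  simpa using integral_norm_sub_sq_le hα hlam hu zero ht

theorem integral_norm_galilean_sub_sq_le (hα : 0 < α)
    (hlam : α * |lam.re| / (2 * √(α + 1)) ≤ lam.im) (hu : IsRapidSolution c₂ c₁ c₀ α lam u)
    (ε : ℝ) {t : ℝ} (ht : 0 ≤ t) :
    ∫ x, ‖_root_.galilean c₂ c₁ ε u t x - u t x‖ ^ 2 ≤ ε ^ 2 * ∫ x : ℝ, ‖(x : ℂ) * u 0 x‖ ^ 2 := by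
  refine (integral_norm_sub_sq_le hα hlam (hu.galilean ε) hu ht).trans ?_
  rw [← integral_const_mul]
  refine integral_mono
    (((hu.galilean ε).rapidDecay.sub hu.rapidDecay).slice le_rfl).integrable_norm_sq
    ((hu.rapidDecay.space_mul.slice le_rfl).integrable_norm_sq.const_mul _) fun x => ?_
  have h := Real.norm_exp_I_mul_ofReal_sub_one_le (x := ε * x)
  have h1 : ‖Complex.exp (Complex.I * (ε * x : ℝ)) * u 0 x - u 0 x‖ ≤ ‖ε * x‖ * ‖u 0 x‖ := by
    rw [← sub_one_mul, norm_mul]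
    gcongr
  simp only [galilean_initial]
  refine (pow_le_pow_left₀ (norm_nonneg _) h1 2).trans_eq ?_
  simp only [norm_mul, mul_pow, Complex.norm_real, Real.norm_eq_abs, sq_abs]
  ring

theorem integral_norm_second_difference_initial_le (hu : IsRapidSolution c₂ c₁ c₀ α lam u)
    (ε : ℝ) : √(∫ x, ‖_root_.galilean c₂ c₁ ε u 0 x - 2 * u 0 x
        + _root_.galilean c₂ c₁ (-ε) u 0 x‖ ^ 2) ≤
      ε ^ 2 * √(∫ x : ℝ, ‖(x : ℂ) ^ 2 * u 0 x‖ ^ 2) := by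
  rw [← Real.sqrt_sq (sq_nonneg ε), ← Real.sqrt_mul (by positivity), ← integral_const_mul]
  refine Real.sqrt_le_sqrt (integral_mono
    ((((hu.galilean ε).rapidDecay.sub (hu.rapidDecay.const_mul 2)).add
      (hu.galilean (-ε)).rapidDecay).slice le_rfl).integrable_norm_sq
    (QuadDecay.integrable_norm_sq ?_ |>.const_mul _) fun x => ?_)
  · simpa only [sq, mul_assoc] using hu.rapidDecay.space_mul.space_mul.slice le_rfl
  have h : ‖_root_.galilean c₂ c₁ ε u 0 x - 2 * u 0 x + _root_.galilean c₂ c₁ (-ε) u 0 x‖ ≤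
      (ε * x) ^ 2 * ‖u 0 x‖ := by
    rw [galilean_initial, galilean_initial, ← sub_mul, ← add_mul, norm_mul]
    gcongr
    simpa using norm_exp_second_difference_le (ε * x)
  refine (pow_le_pow_left₀ (norm_nonneg _) h 2).trans_eq ?_
  simp only [norm_mul, norm_pow, mul_pow, Complex.norm_real, Real.norm_eq_abs, sq_abs]
  ring

theorem integral_norm_vectorField_sq_le (hα : 0 < α)
    (hlam : α * |lam.re| / (2 * √(α + 1)) ≤ lam.im) (hu : IsRapidSolution c₂ c₁ c₀ α lam u)
    (hux : ∀ t, 0 ≤ t → ∀ x, HasDerivAt (u t) (ux t x) x) (hdx : RapidDecay ux)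
    {t : ℝ} (ht : 0 ≤ t) :
    ∫ x, ‖vectorField c₂ c₁ u ux t x‖ ^ 2 ≤ ∫ x : ℝ, ‖(x : ℂ) * u 0 x‖ ^ 2 := by
  have hdec := (hu.rapidDecay.vectorField hdx c₂ c₁).const_mul Complex.I
  have h := QuadDecay.integral_norm_sq_le_of_tendsto (l := 𝓝[≠] (0 : ℝ))
    (F := fun ε x => (ε : ℂ)⁻¹ * (_root_.galilean c₂ c₁ ε u t x - u t x))
    (M := ∫ x : ℝ, ‖(x : ℂ) * u 0 x‖ ^ 2)
    (fun ε => (((hu.galilean ε).rapidDecay.sub hu.rapidDecay).slice ht).const_mul _)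
    (hdec.slice ht) (fun x => ?_) ?_
  · simpa using h
  · have hs := (hasDerivAt_galilean (c₂ := c₂) (c₁ := c₁) (hux t ht) 0 x).tendsto_slope
    simpa [slope_fun_def, galilean_zero, Complex.real_smul] using hs
  · filter_upwards [self_mem_nhdsWithin] with ε hε
    have hε : ε ≠ 0 := hε
    have h := integral_norm_galilean_sub_sq_le hα hlam hu ε ht
    simp only [norm_mul, mul_pow, integral_const_mul]
    rw [norm_inv, Complex.norm_real, inv_pow, Real.norm_eq_abs, sq_abs,
      inv_mul_le_iff₀ (by positivity)]
    simpa only [norm_mul, mul_pow] using h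

end IsRapidSolution

theorem RapidDecay.norm_sq_le_vectorField {c₂ c₁ t : ℝ} {f f' : ℝ → ℝ → ℂ} (hf : RapidDecay f)
    (hf' : RapidDecay f') (hd : ∀ x, HasDerivAt (f t) (f' t x) x) (hc₂ : 0 < c₂) (ht : 0 < t)
    (x : ℝ) : ‖f t x‖ ^ 2 ≤ √(∫ x, ‖f t x‖ ^ 2) *
      √(∫ x, ‖_root_.vectorField c₂ c₁ f f' t x‖ ^ 2) / (c₂ * t) := by
  refine (QuadDecay.norm_sq_le (κ := 2 * c₂ * t) (by positivity) (r := fun x => x + c₁ * t)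
    (hf.slice ht.le) (hf'.slice ht.le) ((hf.vectorField hf' c₂ c₁).slice ht.le) hd
    (fun x => ?_) x).trans_eq ?_
  · simp only [_root_.vectorField]
    push_cast
    ring
  · field_simp

theorem div_sqrt_rpow_mul {K α τ : ℝ} (hK : 0 ≤ K) (hα : 1 ≤ α) (hτ : 0 < τ) (p : ℝ) :
    (K / √τ) ^ (α - 1) * (p / √τ) * K = p * K ^ α * τ ^ (-(α / 2)) := by
  have hs : 0 < √τ := Real.sqrt_pos.2 hτ
  have h1 : K ^ (α - 1) * K = K ^ α := by
    conv_lhs => rw [← Real.rpow_one K, ← Real.rpow_mul hK, one_mul]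
    rw [← Real.rpow_add_of_nonneg hK (by linarith) zero_le_one, sub_add_cancel]
  have h2 : √τ ^ (α - 1) * √τ = τ ^ (α / 2) := by
    rw [← Real.rpow_add_one hs.ne', sub_add_cancel, Real.sqrt_eq_rpow, ← Real.rpow_mul hτ.le]
    congr 1; ring
  rw [Real.div_rpow hK hs.le, Real.rpow_neg hτ.le, ← h1, ← h2]
  have : √τ ^ (α - 1) ≠ 0 := (Real.rpow_pos_of_pos hs _).ne'
  field_simp

namespace IsRapidSolution

variable {c₂ c₁ c₀ α : ℝ} {lam : ℂ} {u ut ux uxx : ℝ → ℝ → ℂ}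

theorem sqrt_integral_norm_second_difference_le (hα1 : 1 ≤ α) (hα2 : α < 2)
    (hlam : α * |lam.re| / (2 * √(α + 1)) ≤ lam.im) (hc₂ : 0 < c₂)
    (hu : IsRapidSolution c₂ c₁ c₀ α lam u)
    (hux : ∀ t, 0 ≤ t → ∀ x, HasDerivAt (u t) (ux t x) x) (hdx : RapidDecay ux)
    {T K P : ℝ} (hP : 0 ≤ P)
    (hN : √(∫ x, ‖u 0 x‖ ^ 2) ≤ K) (hX : √(∫ x : ℝ, ‖(x : ℂ) * u 0 x‖ ^ 2) ≤ K)
    (hL : ∀ t ∈ Ioo 0 T, ∀ x, ‖vectorField c₂ c₁ u ux t x‖ ≤ P / √(c₂ * t))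
    {ε : ℝ} (hε : 0 ≤ ε) {t : ℝ} (ht : t ∈ Icc 0 T) :
    √(∫ x, ‖_root_.galilean c₂ c₁ ε u t x - 2 * u t x
        + _root_.galilean c₂ c₁ (-ε) u t x‖ ^ 2) ≤
      ε ^ 2 * (√(∫ x : ℝ, ‖(x : ℂ) ^ 2 * u 0 x‖ ^ 2) +
        2 * ‖lam‖ * (α ^ 2 + 5 * α) * c₂ ^ (-(α / 2)) * K ^ α * P / (1 - α / 2)
          * t ^ (1 - α / 2)) := by
  have hα0 : 0 < α := by linarith
  have hK : 0 ≤ K := (Real.sqrt_nonneg _).trans hN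
  have hdec := ((hu.galilean ε).rapidDecay.sub (hu.rapidDecay.const_mul 2)).add
    (hu.galilean (-ε)).rapidDecay
  set A := 2 * ‖lam‖ * (α ^ 2 + 5 * α) * c₂ ^ (-(α / 2)) * K ^ α * P with hA
  have hA0 : 0 ≤ A := by positivity
  have hderiv : ∀ s ∈ Ioo 0 T, ∃ E', HasDerivAt (fun t => ∫ x, ‖_root_.galilean c₂ c₁ ε u t x
      - 2 * u t x + _root_.galilean c₂ c₁ (-ε) u t x‖ ^ 2) E' s ∧
      E' ≤ 2 * (ε ^ 2 * A * s ^ (-(α / 2))) * √(∫ x, ‖_root_.galilean c₂ c₁ ε u s x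
        - 2 * u s x + _root_.galilean c₂ c₁ (-ε) u s x‖ ^ 2) := by
    intro s hs
    have hτ : 0 < c₂ * s := mul_pos hc₂ hs.1
    have hS : ∀ x, ‖u s x‖ ≤ K / √(c₂ * s) := by
      intro x
      have h1 : √(∫ x, ‖u s x‖ ^ 2) ≤ K :=
        (Real.sqrt_le_sqrt (integral_norm_sq_le hα0 hlam hu hs.1.le)).trans hN
      have h2 : √(∫ x, ‖vectorField c₂ c₁ u ux s x‖ ^ 2) ≤ K :=
        (Real.sqrt_le_sqrt (integral_norm_vectorField_sq_le hα0 hlam hu hux hdx hs.1.le)).trans hX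
      refine abs_le_of_sq_le_sq' ?_ (by positivity) |>.2
      rw [div_pow, Real.sq_sqrt hτ.le, sq K]
      refine (hu.rapidDecay.norm_sq_le_vectorField (c₁ := c₁) hdx (hux s hs.1.le) hc₂ hs.1 x).trans
        ?_
      gcongr
    have hQ : ∀ δ : ℝ, |δ| = ε →
        √(∫ x, ‖_root_.galilean c₂ c₁ δ u s x - u s x‖ ^ 2) ≤ ε * K := by
      intro δ hδ
      refine (Real.sqrt_le_sqrt
        (integral_norm_galilean_sub_sq_le hα0 hlam hu δ hs.1.le)).trans ?_
      rw [Real.sqrt_mul (sq_nonneg δ), Real.sqrt_sq_eq_abs, hδ]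
      gcongr
    have hdiff : ∀ δ : ℝ, |δ| = ε →
        ∀ x, ‖_root_.galilean c₂ c₁ δ u s x - u s x‖ ≤ P / √(c₂ * s) * ε := by
      intro δ hδ x
      have := norm_galilean_sub_le (hux s hs.1.le) (hL s hs) δ x
      rwa [hδ] at this
    have hε1 : |ε| = ε := abs_of_nonneg hε
    have hε2 : |-ε| = ε := by rw [abs_neg, hε1]
    obtain ⟨E', h1, h2⟩ := hasDerivAt_second_difference hα1 hlam (hu.galilean ε) hu
      (hu.galilean (-ε)) hs.1 (fun x => by rw [norm_galilean]; exact hS _) hS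
      (fun x => by rw [norm_galilean]; exact hS _) (hdiff ε hε1) (hdiff (-ε) hε2)
      (hQ ε hε1) (hQ (-ε) hε2)
    refine ⟨E', h1, h2.trans_eq ?_⟩
    congr 2
    have h := div_sqrt_rpow_mul hK hα1 hτ P
    rw [Real.mul_rpow hc₂.le hs.1.le] at h
    rw [hA]
    linear_combination 2 * ‖lam‖ * (α ^ 2 + 5 * α) * ε ^ 2 * h
  choose! E' hE hE' using hderiv
  have h := sqrt_le_of_deriv_le_mul_sqrt (by linarith : α / 2 < 1)
    (fun s => integral_nonneg fun x => by positivity) (hdec.continuousOn_integral_norm_sq T)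
    hE (by positivity) hE' ht
  refine h.trans ?_
  have h0 := hu.integral_norm_second_difference_initial_le ε
  rw [mul_add]
  refine add_le_add h0 (le_of_eq ?_)
  ring

theorem sqrt_integral_norm_vectorField_sq_le_of_bound (hα1 : 1 ≤ α) (hα2 : α < 2)
    (hlam : α * |lam.re| / (2 * √(α + 1)) ≤ lam.im) (hc₂ : 0 < c₂)
    (hu : IsRapidSolution c₂ c₁ c₀ α lam u) (hR : RapidC12 u ut ux uxx) {L L' : ℝ → ℝ → ℂ}
    (hL : L = vectorField c₂ c₁ u ux) (hL' : L' = fun t x => u t x + vectorField c₂ c₁ ux uxx t x)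
    {T K B : ℝ} (hN : √(∫ x, ‖u 0 x‖ ^ 2) ≤ K) (hX : √(∫ x : ℝ, ‖(x : ℂ) * u 0 x‖ ^ 2) ≤ K)
    (hB : ∀ t ∈ Icc 0 T, √(∫ x, ‖vectorField c₂ c₁ L L' t x‖ ^ 2) ≤ B)
    {t : ℝ} (ht : t ∈ Icc 0 T) :
    √(∫ x, ‖vectorField c₂ c₁ L L' t x‖ ^ 2) ≤ √(∫ x : ℝ, ‖(x : ℂ) ^ 2 * u 0 x‖ ^ 2) +
      2 * ‖lam‖ * (α ^ 2 + 5 * α) * c₂ ^ (-(α / 2)) * K ^ α * √(K * B) / (1 - α / 2)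
        * t ^ (1 - α / 2) := by
  have hα0 : 0 < α := by linarith
  have hK : 0 ≤ K := (Real.sqrt_nonneg _).trans hN
  have hB0 : 0 ≤ B := (Real.sqrt_nonneg _).trans (hB t ht)
  have hdL : RapidDecay L := hL ▸ hR.decay.vectorField hR.decay_x c₂ c₁
  have hdL' : RapidDecay L' := hL' ▸ hR.decay.add (hR.decay_x.vectorField hR.decay_xx c₂ c₁)
  have hderL : ∀ t, 0 ≤ t → ∀ x, HasDerivAt (L t) (L' t x) x := by
    intro t ht x
    rw [hL, hL']
    exact hasDerivAt_vectorField (hR.deriv_x t ht x) (hR.deriv_xx t ht x)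
  have hsup : ∀ s ∈ Ioo 0 T, ∀ x, ‖vectorField c₂ c₁ u ux s x‖ ≤ √(K * B) / √(c₂ * s) := by
    intro s hs x
    rw [← hL, ← Real.sqrt_div (by positivity)]
    have hτ : 0 < c₂ * s := mul_pos hc₂ hs.1
    refine Real.le_sqrt_of_sq_le ?_
    refine (hdL.norm_sq_le_vectorField (c₁ := c₁) hdL' (hderL s hs.1.le) hc₂ hs.1 x).trans ?_
    have h1 : √(∫ x, ‖L s x‖ ^ 2) ≤ K := by
      rw [hL]
      exact (Real.sqrt_le_sqrt (integral_norm_vectorField_sq_le hα0 hlam hu hR.deriv_x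
        hR.decay_x hs.1.le)).trans hX
    have h2 := hB s ⟨hs.1.le, hs.2.le⟩
    gcongr
  have hkey := fun {ε : ℝ} (hε : 0 ≤ ε) => sqrt_integral_norm_second_difference_le hα1 hα2 hlam
    hc₂ hu hR.deriv_x hR.decay_x (Real.sqrt_nonneg _) hN hX hsup hε ht
  set M := √(∫ x : ℝ, ‖(x : ℂ) ^ 2 * u 0 x‖ ^ 2) +
      2 * ‖lam‖ * (α ^ 2 + 5 * α) * c₂ ^ (-(α / 2)) * K ^ α * √(K * B) / (1 - α / 2)
        * t ^ (1 - α / 2) with hM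
  have hM0 : 0 ≤ M := by
    have h1 : 0 ≤ 1 - α / 2 := by linarith
    have h2 : 0 ≤ t ^ (1 - α / 2) := Real.rpow_nonneg ht.1 _
    positivity
  have hdec := (hdL.vectorField hdL' c₂ c₁).const_mul (-1)
  have h := QuadDecay.integral_norm_sq_le_of_tendsto (l := 𝓝[>] (0 : ℝ))
    (F := fun ε x => ((ε : ℂ) ^ 2)⁻¹ * (_root_.galilean c₂ c₁ ε u t x - 2 * u t x
      + _root_.galilean c₂ c₁ (-ε) u t x)) (M := M ^ 2)
    (fun ε => ((((hu.galilean ε).rapidDecay.sub (hu.rapidDecay.const_mul 2)).add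
      (hu.galilean (-ε)).rapidDecay).slice ht.1).const_mul _)
    (hdec.slice ht.1) (fun x => ?_) ?_
  · refine Real.sqrt_le_iff.2 ⟨hM0, ?_⟩
    simpa using h
  · have h1 := hasDerivAt_galilean (c₂ := c₂) (c₁ := c₁) (hderL t ht.1) 0 x
    have h2 := tendsto_second_difference
      (fun s => hasDerivAt_galilean (c₂ := c₂) (c₁ := c₁) (hR.deriv_x t ht.1) s x)
      (by rw [← hL]; exact h1.const_mul Complex.I)
    simpa [galilean_zero, ← mul_assoc] using h2
  · filter_upwards [self_mem_nhdsWithin] with ε hε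
    have hε : 0 < ε := hε
    have h := Real.sqrt_le_iff.1 (hkey hε.le)
    simp only [norm_mul, mul_pow, integral_const_mul]
    rw [norm_inv, norm_pow, Complex.norm_real, inv_pow, Real.norm_eq_abs, sq_abs,
      inv_mul_le_iff₀ (by positivity), ← mul_pow]
    exact h.2

theorem sqrt_integral_norm_vectorField_sq_le (hα1 : 1 ≤ α) (hα2 : α < 2)
    (hlam : α * |lam.re| / (2 * √(α + 1)) ≤ lam.im) (hc₂ : 0 < c₂)
    (hu : IsRapidSolution c₂ c₁ c₀ α lam u) (hR : RapidC12 u ut ux uxx) {L L' : ℝ → ℝ → ℂ}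
    (hL : L = vectorField c₂ c₁ u ux) (hL' : L' = fun t x => u t x + vectorField c₂ c₁ ux uxx t x)
    {K : ℝ} (hN : √(∫ x, ‖u 0 x‖ ^ 2) ≤ K) (hX : √(∫ x : ℝ, ‖(x : ℂ) * u 0 x‖ ^ 2) ≤ K)
    {T : ℝ} (hT : 0 ≤ T) :
    √(∫ x, ‖vectorField c₂ c₁ L L' T x‖ ^ 2) ≤ 2 * √(∫ x : ℝ, ‖(x : ℂ) ^ 2 * u 0 x‖ ^ 2) +
      (2 * ‖lam‖ * (α ^ 2 + 5 * α) * c₂ ^ (-(α / 2)) / (1 - α / 2)) ^ 2 *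
        (K ^ (2 * α + 1) * T ^ (2 - α)) := by
  have hK : 0 ≤ K := (Real.sqrt_nonneg _).trans hN
  have hdL : RapidDecay L := hL ▸ hR.decay.vectorField hR.decay_x c₂ c₁
  have hdL' : RapidDecay L' := hL' ▸ hR.decay.add (hR.decay_x.vectorField hR.decay_xx c₂ c₁)
  set s := (fun t => √(∫ x, ‖vectorField c₂ c₁ L L' t x‖ ^ 2)) '' Icc 0 T with hs
  have hbdd : BddAbove s := by
    obtain ⟨B, hB⟩ := (hdL.vectorField hdL' c₂ c₁).exists_integral_norm_sq_le T
    refine ⟨√B, ?_⟩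
    rintro _ ⟨t, ht, rfl⟩
    exact Real.sqrt_le_sqrt (hB t ht)
  have hmem : ∀ t ∈ Icc 0 T, √(∫ x, ‖vectorField c₂ c₁ L L' t x‖ ^ 2) ≤ sSup s :=
    fun t ht => le_csSup hbdd ⟨t, ht, rfl⟩
  have hm0 : 0 ≤ sSup s := (Real.sqrt_nonneg _).trans (hmem T ⟨hT, le_rfl⟩)
  set D := 2 * ‖lam‖ * (α ^ 2 + 5 * α) * c₂ ^ (-(α / 2)) / (1 - α / 2) with hD
  have hθ : 0 ≤ 1 - α / 2 := by linarith
  have hD0 : 0 ≤ D := by positivity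
  have hsup : sSup s ≤ √(∫ x : ℝ, ‖(x : ℂ) ^ 2 * u 0 x‖ ^ 2) +
      D * K ^ α * √K * T ^ (1 - α / 2) * √(sSup s) := by
    refine csSup_le ⟨_, T, ⟨hT, le_rfl⟩, rfl⟩ ?_
    rintro _ ⟨t, ht, rfl⟩
    refine (sqrt_integral_norm_vectorField_sq_le_of_bound hα1 hα2 hlam hc₂ hu hR hL hL' hN hX
      hmem ht).trans ?_
    refine add_le_add le_rfl ?_
    have h1 : t ^ (1 - α / 2) ≤ T ^ (1 - α / 2) := Real.rpow_le_rpow ht.1 ht.2 hθ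
    calc _ = D * K ^ α * √K * t ^ (1 - α / 2) * √(sSup s) := by
          rw [Real.sqrt_mul hK, hD]; ring
      _ ≤ _ := by gcongr
  refine (hmem T ⟨hT, le_rfl⟩).trans ((le_of_le_add_mul_sqrt hm0 hsup).trans_eq ?_)
  have h1 : (K ^ α) ^ 2 * K = K ^ (2 * α + 1) := by
    rw [← Real.rpow_mul_natCast hK, Real.rpow_add_of_nonneg hK (by linarith) zero_le_one,
      Real.rpow_one, mul_comm α]
    norm_num
  have h2 : (T ^ (1 - α / 2)) ^ 2 = T ^ (2 - α) := by
    rw [← Real.rpow_mul_natCast hT]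
    congr 1; push_cast; ring
  rw [← h1, ← h2, mul_pow, mul_pow, mul_pow, Real.sq_sqrt hK]
  ring

end IsRapidSolution

theorem Lop_Lop_eq_vectorField {c₂ c₁ : ℝ} {u ut ux uxx : ℝ → ℝ → ℂ} (hR : RapidC12 u ut ux uxx)
    {t : ℝ} (ht : 0 ≤ t) : Lop c₂ c₁ (Lop c₂ c₁ u) t = vectorField c₂ c₁
      (vectorField c₂ c₁ u ux) (fun t x => u t x + vectorField c₂ c₁ ux uxx t x) t := by
  have h1 : Lop c₂ c₁ u t = vectorField c₂ c₁ u ux t := by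
    ext x
    simp only [Lop, vectorField, (hR.deriv_x t ht x).deriv]
  ext x
  have h2 : HasDerivAt (fun y => Lop c₂ c₁ u t y)
      (u t x + vectorField c₂ c₁ ux uxx t x) x := by
    rw [h1]
    exact hasDerivAt_vectorField (hR.deriv_x t ht x) (hR.deriv_xx t ht x)
  rw [Lop, h2.deriv, h1]
  rfl

/-- For `1 ≤ α < 2` and `λ₂ ≥ α|λ₁|/(2√(α+1))`, there is `C > 0`
(depending only on `α`, `λ` and `c₂`) such that for all `t ≥ 0`,
`‖(𝓛²u)(t,·)‖_{L²} ≤ C (‖u₀‖_{L²} + ‖x² u₀‖_{L²} + (‖u₀‖_{L²} + ‖x u₀‖_{L²})^{2α+1} t^{2−α})`. -/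
theorem L2_bound_vector_field_squared (α : ℝ) (hα1 : 1 ≤ α) (hα2 : α < 2)
    (lam : ℂ) (hlam : α * |lam.re| / (2 * Real.sqrt (α + 1)) ≤ lam.im)
    (c₂ : ℝ) (hc₂ : 0 < c₂) :
    ∃ C : ℝ, 0 < C ∧ ∀ c₁ c₀ : ℝ, ∀ u : ℝ → ℝ → ℂ, ∀ u₀ : ℝ → ℂ,
      SchwartzSolution c₂ c₁ c₀ α lam u →
      (∀ x : ℝ, u 0 x = u₀ x) →
      ∀ t : ℝ, 0 ≤ t →
        Real.sqrt (∫ x : ℝ, ‖Lop c₂ c₁ (Lop c₂ c₁ u) t x‖ ^ 2) ≤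
          C * (Real.sqrt (∫ y : ℝ, ‖u₀ y‖ ^ 2)
            + Real.sqrt (∫ y : ℝ, ‖((y : ℂ) ^ 2) * u₀ y‖ ^ 2)
            + (Real.sqrt (∫ y : ℝ, ‖u₀ y‖ ^ 2)
                + Real.sqrt (∫ y : ℝ, ‖(y : ℂ) * u₀ y‖ ^ 2)) ^ (2 * α + 1)
              * t ^ (2 - α)) := by
  set D := 2 * ‖lam‖ * (α ^ 2 + 5 * α) * c₂ ^ (-(α / 2)) / (1 - α / 2) with hD
  refine ⟨2 + D ^ 2, by positivity, fun c₁ c₀ u u₀ S hu₀ t ht => ?_⟩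
  have hR := RapidC12.of_schwartzSolution S
  have hinit : u₀ = u 0 := funext fun x => (hu₀ x).symm
  rw [hinit, Lop_Lop_eq_vectorField hR ht]
  have h := IsRapidSolution.sqrt_integral_norm_vectorField_sq_le hα1 hα2 hlam hc₂
    (IsRapidSolution.of_schwartzSolution S) hR rfl rfl
    (le_add_of_nonneg_right (Real.sqrt_nonneg (∫ y : ℝ, ‖(y : ℂ) * u 0 y‖ ^ 2)))
    (le_add_of_nonneg_left (Real.sqrt_nonneg (∫ y : ℝ, ‖u 0 y‖ ^ 2))) ht
  rw [← hD] at h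
  refine h.trans ?_
  have hN := Real.sqrt_nonneg (∫ y : ℝ, ‖u 0 y‖ ^ 2)
  have hY := Real.sqrt_nonneg (∫ y : ℝ, ‖(y : ℂ) ^ 2 * u 0 y‖ ^ 2)
  set W := (√(∫ y : ℝ, ‖u 0 y‖ ^ 2) + √(∫ y : ℝ, ‖(y : ℂ) * u 0 y‖ ^ 2)) ^ (2 * α + 1)
    * t ^ (2 - α)
  have hW : 0 ≤ W := by positivity
  nlinarith [mul_nonneg (sq_nonneg D) hN, mul_nonneg (sq_nonneg D) hY]

end
end
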